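/- arXiv:1108.2188 — 13 statements merged into one kernel-verified Lean document; each statement's English description precedes it below -/
import Mathlib

section
/- Let α ∈ ℂ, let U ⊆ ℂ be open, and let w solve [II_α] on U. Assume V(z) := w'(z) + w(z)² + z/2 is nonvanishing on U. Then the Bäcklund transform w₁ := −w − (α + 1/2)/V solves [II_{α+1}] on U, i.e. w₁''(z) = (α+1) + z·w₁(z) + 2·w₁(z)³ for all z ∈ U. -/
/-- The Bäcklund transform `w₁ = −w − (α + 1/2)/(w' + w² + z/2)` maps solutions of
`[II_α]` to solutions of `[II_{α+1}]`. -/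
theorem backlund_up (α : ℂ) (U : Set ℂ) (hU : IsOpen U) (w : ℂ → ℂ)
    (hw : AnalyticOnNhd ℂ w U)
    (hODE : ∀ z ∈ U, deriv (deriv w) z = α + z * w z + 2 * (w z) ^ 3)
    (hV : ∀ z ∈ U, deriv w z + (w z) ^ 2 + z / 2 ≠ 0)
    (w₁ : ℂ → ℂ)
    (hw₁ : w₁ = fun z => -w z - (α + 1 / 2) / (deriv w z + (w z) ^ 2 + z / 2)) :
    AnalyticOnNhd ℂ w₁ U ∧
      ∀ z ∈ U, deriv (deriv w₁) z = (α + 1) + z * w₁ z + 2 * (w₁ z) ^ 3 := by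
  set V : ℂ → ℂ := fun z => deriv w z + (w z) ^ 2 + z / 2 with hVdef
  have hV0 : ∀ z ∈ U, V z ≠ 0 := hV
  have hw₁V : ∀ z, w₁ z = -w z - (α + 1 / 2) / V z := fun z => by rw [hw₁]
  have hanV : AnalyticOnNhd ℂ V U := fun z hz =>
    ((hw z hz).deriv.add ((hw z hz).pow 2)).add (analyticAt_id.div_const (c := 2))
  have hderivV : ∀ z ∈ U, HasDerivAt V (-(α + 1 / 2) - 2 * w₁ z * V z) z := by
    intro z hz
    have hV' := ((hw z hz).deriv.differentiableAt.hasDerivAt.add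
      ((hw z hz).differentiableAt.hasDerivAt.pow 2)).add ((hasDerivAt_id z).div_const 2)
    refine hV'.congr_deriv ?_
    have hmul : w₁ z * V z = -w z * V z - (α + 1 / 2) := by
      rw [hw₁V]
      field_simp [hV0 z hz]
    rw [hODE z hz, mul_assoc 2 (w₁ z), hmul]
    simp only [hVdef]
    push_cast
    ring
  -- The transform satisfies the Riccati-type relation `w₁' = w₁² + z/2 - V`.
  have hderiv : ∀ z ∈ U, HasDerivAt w₁ ((w₁ z) ^ 2 + z / 2 - V z) z := by
    intro z hz
    have h := (hw z hz).differentiableAt.hasDerivAt.neg.sub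
      ((hasDerivAt_const z (α + 1 / 2)).div (hderivV z hz) (hV0 z hz))
    have heq : w₁ = -w - (fun _ => α + 1 / 2) / V := funext hw₁V
    rw [← heq] at h
    refine h.congr_deriv ?_
    have hdw : deriv w z = V z - (w z) ^ 2 - z / 2 := by simp only [hVdef]; ring
    rw [hdw, hw₁V]
    field_simp [hV0 z hz]
    ring
  refine ⟨?_, fun z hz => ?_⟩
  · rw [hw₁]
    exact fun z hz => (hw z hz).neg.sub (analyticAt_const.div (hanV z hz) (hV0 z hz))
  · have hev : deriv w₁ =ᶠ[nhds z] fun x => (w₁ x) ^ 2 + x / 2 - V x :=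
      Filter.eventually_of_mem (hU.mem_nhds hz) fun x hx => (hderiv x hx).deriv
    rw [hev.deriv_eq]
    have h := (((hderiv z hz).pow 2).add ((hasDerivAt_id z).div_const 2)).sub (hderivV z hz)
    refine h.deriv.trans ?_
    push_cast
    ring
end

section
/- Let α ∈ ℂ, let U ⊆ ℂ be open, and let w solve [II_α] on U. Assume V₋(z) := w'(z) − w(z)² − z/2 is nonvanishing on U. Then the Bäcklund transform w₋₁ := −w + (α − 1/2)/V₋ solves [II_{α−1}] on U, i.e. w₋₁''(z) = (α−1) + z·w₋₁(z) + 2·w₋₁(z)³ for all z ∈ U. -/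
/-- Along a solution of `[II_α]`, the function `V = w' − w² − z/2` satisfies the Riccati-type
relation `V' = (α − 1/2) − 2wV`. -/
theorem hasDerivAt_painleveII_V {α z : ℂ} {w : ℂ → ℂ} (hw : AnalyticAt ℂ w z)
    (hODE : deriv (deriv w) z = α + z * w z + 2 * (w z) ^ 3) :
    HasDerivAt (fun x => deriv w x - (w x) ^ 2 - x / 2)
      ((α - 1 / 2) - 2 * w z * (deriv w z - (w z) ^ 2 - z / 2)) z := by
  have h := (hw.deriv.differentiableAt.hasDerivAt.sub
    (hw.differentiableAt.hasDerivAt.pow 2)).sub ((hasDerivAt_id z).div_const 2)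
  refine h.congr_deriv ?_
  rw [hODE]
  push_cast
  ring

/-- The Bäcklund transform `W = −w + (α − 1/2)/V` satisfies `W' = −V − z/2 − W²`. -/
theorem hasDerivAt_backlund_down {α z : ℂ} {w : ℂ → ℂ} (hw : AnalyticAt ℂ w z)
    (hODE : deriv (deriv w) z = α + z * w z + 2 * (w z) ^ 3)
    (hV : deriv w z - (w z) ^ 2 - z / 2 ≠ 0) :
    HasDerivAt (fun x => -w x + (α - 1 / 2) / (deriv w x - (w x) ^ 2 - x / 2))
      (-(deriv w z - (w z) ^ 2 - z / 2) - z / 2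
        - (-w z + (α - 1 / 2) / (deriv w z - (w z) ^ 2 - z / 2)) ^ 2) z := by
  have h := hw.differentiableAt.hasDerivAt.neg.add
    ((hasDerivAt_const z (α - 1 / 2)).div (hasDerivAt_painleveII_V hw hODE) hV)
  refine h.congr_deriv ?_
  generalize hv : deriv w z - (w z) ^ 2 - z / 2 = v at hV ⊢
  rw [show deriv w z = v + (w z) ^ 2 + z / 2 by rw [← hv]; ring]
  field_simp
  ring

/-- The Bäcklund transform `wm1 = −w + (α − 1/2)/(w' − w² − z/2)` maps solutions of
`[II_α]` to solutions of `[II_{α−1}]`. -/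
theorem backlund_down (α : ℂ) (U : Set ℂ) (hU : IsOpen U) (w : ℂ → ℂ)
    (hw : AnalyticOnNhd ℂ w U)
    (hODE : ∀ z ∈ U, deriv (deriv w) z = α + z * w z + 2 * (w z) ^ 3)
    (hV : ∀ z ∈ U, deriv w z - (w z) ^ 2 - z / 2 ≠ 0)
    (wm1 : ℂ → ℂ)
    (hwm1 : wm1 = fun z => -w z + (α - 1 / 2) / (deriv w z - (w z) ^ 2 - z / 2)) :
    AnalyticOnNhd ℂ wm1 U ∧
      ∀ z ∈ U, deriv (deriv wm1) z = (α - 1) + z * wm1 z + 2 * (wm1 z) ^ 3 := by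
  have hderiv : ∀ z ∈ U, HasDerivAt wm1
      (-(deriv w z - (w z) ^ 2 - z / 2) - z / 2 - (wm1 z) ^ 2) z := by
    intro z hz
    rw [hwm1]
    exact hasDerivAt_backlund_down (hw z hz) (hODE z hz) (hV z hz)
  refine ⟨DifferentiableOn.analyticOnNhd
    (fun z hz => (hderiv z hz).differentiableAt.differentiableWithinAt) hU, fun z hz => ?_⟩
  have heq : deriv wm1 =ᶠ[nhds z]
      fun x => -(deriv w x - (w x) ^ 2 - x / 2) - x / 2 - (wm1 x) ^ 2 := by
    filter_upwards [hU.mem_nhds hz] with x hx using (hderiv x hx).deriv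
  have h := ((hasDerivAt_painleveII_V (hw z hz) (hODE z hz)).neg.sub
    ((hasDerivAt_id z).div_const 2)).sub ((hderiv z hz).pow 2)
  have hmul : (wm1 z + w z) * (deriv w z - (w z) ^ 2 - z / 2) = α - 1 / 2 := by
    rw [hwm1]
    simp [div_mul_cancel₀ _ (hV z hz)]
  rw [heq.deriv_eq]
  refine h.deriv.trans ?_
  push_cast
  linear_combination 2 * hmul
end

section
/- Let a := 2^{−1/3} be the real cube root of 1/2. Let U ⊆ ℂ be open and let y be analytic and nonvanishing on U with y''(z) = z·y(z) + 2·y(z)³ on U. Define w(z) := −(d/dz) log y(−a·z) = a·y'(−a·z)/y(−a·z) on the open set V := {z ∈ ℂ : −a·z ∈ U}. Then w solves [II_{1/2}] on V, i.e. w''(z) = 1/2 + z·w(z) + 2·w(z)³ for all z ∈ V. -/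
/-- The logarithmic derivative `u` of a solution of `[II_0]` satisfies the Riccati
equation `du/dz = z + 2 y² - u²`. -/
lemma hasDerivAt_logDeriv_of_II0 {y : ℂ → ℂ} {z : ℂ} (hy : AnalyticAt ℂ y z) (hy0 : y z ≠ 0)
    (hODE : deriv (deriv y) z = z * y z + 2 * (y z) ^ 3) :
    HasDerivAt (fun z => deriv y z / y z) (z + 2 * y z ^ 2 - (deriv y z / y z) ^ 2) z := by
  have h := hy.deriv.differentiableAt.hasDerivAt.div hy.differentiableAt.hasDerivAt hy0
  refine h.congr_deriv ?_
  rw [hODE]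
  field_simp

/-- Differentiating the Riccati equation eliminates `y`: the second derivative of `u`
is `1 - 2 z u + 2 u³`. -/
lemma hasDerivAt_riccati_of_II0 {y : ℂ → ℂ} {z : ℂ} (hy : AnalyticAt ℂ y z) (hy0 : y z ≠ 0)
    (hODE : deriv (deriv y) z = z * y z + 2 * (y z) ^ 3) :
    HasDerivAt (fun z => z + 2 * y z ^ 2 - (deriv y z / y z) ^ 2)
      (1 - 2 * z * (deriv y z / y z) + 2 * (deriv y z / y z) ^ 3) z := by
  have h := ((hasDerivAt_id z).add ((hy.differentiableAt.hasDerivAt.pow 2).const_mul 2)).sub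
    ((hasDerivAt_logDeriv_of_II0 hy hy0 hODE).pow 2)
  refine h.congr_deriv ?_
  norm_num
  field_simp
  ring

/-- If `y` is a nonvanishing solution of `[II_0]`, then
`w(z) = −(d/dz) log y(−a·z)` with `a = 2^{−1/3}` solves `[II_{1/2}]`. -/
theorem log_deriv_transform_II0_to_IIhalf (a : ℝ) (ha : 0 < a) (ha3 : a ^ 3 = 1 / 2)
    (U : Set ℂ) (hU : IsOpen U) (y : ℂ → ℂ) (hy : AnalyticOnNhd ℂ y U)
    (hy0 : ∀ z ∈ U, y z ≠ 0)
    (hODE : ∀ z ∈ U, deriv (deriv y) z = z * y z + 2 * (y z) ^ 3)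
    (w : ℂ → ℂ) (hw : w = fun z => (a : ℂ) * deriv y (-(a : ℂ) * z) / y (-(a : ℂ) * z))
    (V : Set ℂ) (hV : V = {z : ℂ | -(a : ℂ) * z ∈ U}) :
    AnalyticOnNhd ℂ w V ∧
      ∀ z ∈ V, deriv (deriv w) z = 1 / 2 + z * w z + 2 * (w z) ^ 3 := by
  subst hw hV
  have ha_cube : (a : ℂ) ^ 3 = 1 / 2 := by simpa using congrArg Complex.ofReal ha3
  have hlin : ∀ z : ℂ, HasDerivAt (fun z : ℂ => -(a : ℂ) * z) (-(a : ℂ)) z := fun z => by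
    simpa using (hasDerivAt_id z).const_mul (-(a : ℂ))
  have hlinA : ∀ z : ℂ, AnalyticAt ℂ (fun z : ℂ => -(a : ℂ) * z) z := fun z => by fun_prop
  have hVo : IsOpen {z : ℂ | -(a : ℂ) * z ∈ U} := hU.preimage (by fun_prop)
  refine ⟨fun z hz => ?_, fun z hz => ?_⟩
  · have hyz := hy _ hz
    exact (analyticAt_const.mul (hyz.deriv.fun_comp (hlinA z))).div (hyz.fun_comp (hlinA z)) (hy0 _ hz)
  · have hfirst : deriv (fun z => (a : ℂ) * deriv y (-(a : ℂ) * z) / y (-(a : ℂ) * z)) =ᶠ[nhds z]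
        fun z => (a : ℂ) * ((-(a : ℂ) * z + 2 * y (-(a : ℂ) * z) ^ 2
          - (deriv y (-(a : ℂ) * z) / y (-(a : ℂ) * z)) ^ 2) * -(a : ℂ)) := by
      filter_upwards [hVo.mem_nhds hz] with x hx
      have h := (hasDerivAt_logDeriv_of_II0 (hy _ hx) (hy0 _ hx) (hODE _ hx)).comp x (hlin x)
      simp only [mul_div_assoc]
      exact (h.const_mul (a : ℂ)).deriv
    have h := (hasDerivAt_riccati_of_II0 (hy _ hz) (hy0 _ hz) (hODE _ hz)).comp z (hlin z)
    rw [hfirst.deriv_eq]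
    refine ((h.mul_const (-(a : ℂ))).const_mul (a : ℂ)).deriv.trans ?_
    simp only [mul_div_assoc]
    generalize deriv y (-(a : ℂ) * z) / y (-(a : ℂ) * z) = u
    linear_combination (1 + 2 * a * z * u) * ha_cube
end

section
/- Let α ∈ ℂ, p ∈ ℂ, and let w be analytic on a punctured disc D' = {z : 0 < |z − p| < r} solving [II_α] there, with |w(z)| → ∞ as z → p (a pole at p). Then there exists η ∈ {1, −1} such that g(z) := w(z) − η/(z − p) extends analytically to the full disc {z : |z − p| < r}, and the extension satisfies g(p) = 0, g'(p) = −η·p/6, and g''(p)/2 = −(α + η)/4; in particular every pole of a solution of [II_α] is simple with residue ±1. -/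
open Filter Topology Metric

/-- An analytic function can be expanded to first order with an analytic remainder factor. -/
lemma AnalyticAt.exists_eq_add_sub_mul {f : ℂ → ℂ} {p : ℂ} (hf : AnalyticAt ℂ f p) :
    ∃ g : ℂ → ℂ, AnalyticAt ℂ g p ∧ ∀ z, f z = f p + (z - p) * g z := by
  obtain ⟨q, hq⟩ := hf
  refine ⟨dslope f p, hq.has_fpower_series_dslope_fslope.analyticAt, fun z => ?_⟩
  have h := sub_smul_dslope f p z
  rw [smul_eq_mul] at h
  rw [h]
  ring

/-- If `c + (z - p) R(z)` vanishes near `p`, then so do both its constant term and `R`. -/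
lemma eq_zero_and_eventually_eq_zero_of_add_sub_mul {c p : ℂ} {R : ℂ → ℂ}
    (hR : ContinuousAt R p) (h : ∀ᶠ z in 𝓝[≠] p, c + (z - p) * R z = 0) :
    c = 0 ∧ ∀ᶠ z in 𝓝[≠] p, R z = 0 := by
  have hc : c = 0 := by
    have h1 : Tendsto (fun z => c + (z - p) * R z) (𝓝[≠] p) (𝓝 (c + (p - p) * R p)) :=
      (ContinuousAt.tendsto (by fun_prop)).mono_left nhdsWithin_le_nhds
    have h2 := tendsto_nhds_unique h1 (tendsto_const_nhds.congr' (h.mono fun z hz => hz.symm))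
    simpa using h2
  refine ⟨hc, ?_⟩
  filter_upwards [h, self_mem_nhdsWithin] with z hz hzp
  rw [hc, zero_add] at hz
  exact (mul_eq_zero.mp hz).resolve_left (sub_ne_zero.mpr hzp)

/-- A function holomorphic near `p` except at `p`, whose norm tends to infinity at `p`, is
meromorphic at `p`. -/
lemma meromorphicAt_of_tendsto_norm_atTop {w : ℂ → ℂ} {p : ℂ}
    (hw : ∀ᶠ z in 𝓝[≠] p, DifferentiableAt ℂ w z)
    (hpole : Tendsto (fun z => ‖w z‖) (𝓝[≠] p) atTop) : MeromorphicAt w p := by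
  set f : ℂ → ℂ := Function.update (fun z => (w z)⁻¹) p 0
  have hf : ∀ z ≠ p, f z = (w z)⁻¹ := fun z hz => Function.update_of_ne hz _ _
  have hcont : ContinuousAt f p := by
    rw [continuousAt_update_same, tendsto_zero_iff_norm_tendsto_zero]
    simpa [Pi.inv_def] using hpole.inv_tendsto_atTop
  have hd : ∀ᶠ z in 𝓝[≠] p, DifferentiableAt ℂ f z := by
    filter_upwards [hw, hpole.eventually_gt_atTop 0, self_mem_nhdsWithin] with z hz hpos hzp
    refine (hz.inv (norm_pos_iff.mp hpos)).congr_of_eventuallyEq ?_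
    filter_upwards [isOpen_ne.mem_nhds hzp] with y hy using hf y hy
  refine (Complex.analyticAt_of_differentiable_on_punctured_nhds_of_continuousAt hd
    hcont).meromorphicAt.inv.congr ?_
  filter_upwards [self_mem_nhdsWithin] with z hz
  simp [hf z hz]

/-- Every pole of a solution of `[II_α]` is simple. -/
lemma painleveII_meromorphicOrderAt {α p : ℂ} {w : ℂ → ℂ} (hw : MeromorphicAt w p)
    (hODE : ∀ᶠ z in 𝓝[≠] p, deriv (deriv w) z = α + z * w z + 2 * (w z) ^ 3)
    (hpole : meromorphicOrderAt w p < 0) : meromorphicOrderAt w p = (-1 : ℤ) := by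
  obtain ⟨n, hn⟩ := WithTop.ne_top_iff_exists.mp (hpole.trans WithTop.top_pos).ne
  rw [← hn] at hpole ⊢
  have hn0 : n < 0 := by exact_mod_cast hpole
  have hd := meromorphicOrderAt_deriv_eq_sub_one (𝕜 := ℂ) (by exact_mod_cast hn0.ne) hn.symm
  have hdd := meromorphicOrderAt_deriv_eq_sub_one (𝕜 := ℂ)
    (by exact_mod_cast (show n - 1 < 0 by lia).ne) hd
  have hsq : meromorphicOrderAt (w ^ 2) p = ((2 * n : ℤ) : WithTop ℤ) := by
    rw [meromorphicOrderAt_pow hw, ← hn]; rfl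
  have hid : MeromorphicAt (fun z : ℂ => z) p := analyticAt_id.meromorphicAt
  have hlow : meromorphicOrderAt ((fun z => z) + (fun _ => 2) * w ^ 2) p
      = ((2 * n : ℤ) : WithTop ℤ) := by
    have h2 : meromorphicOrderAt ((fun _ => 2) * w ^ 2) p = ((2 * n : ℤ) : WithTop ℤ) := by
      rw [meromorphicOrderAt_mul (MeromorphicAt.const 2 p) (hw.pow 2), hsq,
        meromorphicOrderAt_const]
      simp
    rw [meromorphicOrderAt_add_eq_right_of_lt hid, h2]
    rw [h2]
    refine lt_of_lt_of_le ?_ (analyticAt_id (𝕜 := ℂ) (z := p)).meromorphicOrderAt_nonneg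
    exact_mod_cast (show 2 * n < 0 by lia)
  have hmul : meromorphicOrderAt (w * ((fun z => z) + (fun _ => 2) * w ^ 2)) p
      = ((3 * n : ℤ) : WithTop ℤ) := by
    rw [meromorphicOrderAt_mul hw (hid.add ((MeromorphicAt.const 2 p).mul (hw.pow 2))), hlow, ← hn]
    norm_cast
    ring
  have hrhs : meromorphicOrderAt ((fun _ => α) + w * ((fun z => z) + (fun _ => 2) * w ^ 2)) p
      = ((3 * n : ℤ) : WithTop ℤ) := by
    rw [meromorphicOrderAt_add_eq_right_of_lt (MeromorphicAt.const α p), hmul]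
    rw [hmul]
    refine lt_of_lt_of_le ?_ (analyticAt_const (𝕜 := ℂ) (x := p)).meromorphicOrderAt_nonneg
    exact_mod_cast (show 3 * n < 0 by lia)
  have heq := meromorphicOrderAt_congr (f₁ := deriv (deriv w))
    (f₂ := (fun _ => α) + w * ((fun z => z) + (fun _ => 2) * w ^ 2)) (hODE.mono fun z hz => by
      rw [hz]
      simp only [Pi.add_apply, Pi.mul_apply, Pi.pow_apply]
      ring)
  rw [hdd, hrhs] at heq
  have : n - 1 - 1 = 3 * n := by exact_mod_cast heq
  exact_mod_cast (show n = -1 by lia)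

/-- Termwise second derivative of a Laurent expansion with a simple pole. -/
lemma deriv_deriv_laurent {w v : ℂ → ℂ} {a b c d p : ℂ} (hv : AnalyticAt ℂ v p)
    (hw : ∀ᶠ z in 𝓝[≠] p,
      w z = a / (z - p) + (b + c * (z - p) + d * (z - p) ^ 2 + (z - p) ^ 3 * v z)) :
    ∀ᶠ z in 𝓝[≠] p, deriv (deriv w) z = 2 * a / (z - p) ^ 3 + (2 * d + 6 * (z - p) * v z
      + 6 * (z - p) ^ 2 * deriv v z + (z - p) ^ 3 * deriv (deriv v) z) := by
  have hv' : ∀ᶠ z in 𝓝[≠] p, AnalyticAt ℂ v z :=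
    hv.eventually_analyticAt.filter_mono nhdsWithin_le_nhds
  have hfirst : deriv w =ᶠ[𝓝[≠] p] fun z => -a / (z - p) ^ 2 + (c + 2 * d * (z - p)
      + 3 * (z - p) ^ 2 * v z + (z - p) ^ 3 * deriv v z) := by
    filter_upwards [EventuallyEq.nhdsNE_deriv hw, hv', self_mem_nhdsWithin] with z hz hvz hzp
    have hne : z - p ≠ 0 := sub_ne_zero.mpr hzp
    have ht : HasDerivAt (fun y : ℂ => y - p) 1 z := (hasDerivAt_id z).sub_const p
    rw [hz]
    refine HasDerivAt.deriv ((((hasDerivAt_const z a).fun_div ht hne).fun_add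
      ((((hasDerivAt_const z b).fun_add (ht.const_mul c)).fun_add
        ((ht.fun_pow 2).const_mul d)).fun_add
        ((ht.fun_pow 3).fun_mul hvz.differentiableAt.hasDerivAt))).congr_deriv ?_)
    field_simp
    ring
  filter_upwards [hfirst.nhdsNE_deriv, hv', self_mem_nhdsWithin] with z hz hvz hzp
  have hne : z - p ≠ 0 := sub_ne_zero.mpr hzp
  have ht : HasDerivAt (fun y : ℂ => y - p) 1 z := (hasDerivAt_id z).sub_const p
  rw [hz]
  refine HasDerivAt.deriv ((((hasDerivAt_const z (-a)).fun_div (ht.fun_pow 2)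
    (pow_ne_zero 2 hne)).fun_add
      ((((hasDerivAt_const z c).fun_add (ht.const_mul (2 * d))).fun_add
        (((ht.fun_pow 2).const_mul 3).fun_mul hvz.differentiableAt.hasDerivAt)).fun_add
        ((ht.fun_pow 3).fun_mul hvz.deriv.differentiableAt.hasDerivAt))).congr_deriv ?_)
  field_simp
  ring

/-- The leading Laurent coefficients of a solution of `[II_α]` at a simple pole. -/
lemma painleveII_laurent_coeffs {α p a b c d : ℂ} {w v : ℂ → ℂ} (ha : a ≠ 0)
    (hv : AnalyticAt ℂ v p)
    (hODE : ∀ᶠ z in 𝓝[≠] p, deriv (deriv w) z = α + z * w z + 2 * (w z) ^ 3)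
    (hw : ∀ᶠ z in 𝓝[≠] p,
      w z = a / (z - p) + (b + c * (z - p) + d * (z - p) ^ 2 + (z - p) ^ 3 * v z)) :
    (a = 1 ∨ a = -1) ∧ b = 0 ∧ c = -a * p / 6 ∧ d = -(α + a) / 4 := by
  have cv : ContinuousAt v p := hv.continuousAt
  have cv1 : ContinuousAt (deriv v) p := hv.deriv.continuousAt
  have cv2 : ContinuousAt (deriv (deriv v)) p := hv.deriv.deriv.continuousAt
  obtain ⟨T, hT⟩ : ∃ T : ℂ → ℂ, T = fun z => c + (z - p) * (d + (z - p) * v z) := ⟨_, rfl⟩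
  have cT : ContinuousAt T p := by rw [hT]; fun_prop
  obtain ⟨S, hS⟩ : ∃ S : ℂ → ℂ, S = fun z => b + (z - p) * T z := ⟨_, rfl⟩
  have cS : ContinuousAt S p := by rw [hS]; fun_prop
  obtain ⟨E, hE⟩ : ∃ E : ℂ → ℂ, E = fun z => 6 * v z + 6 * (z - p) * deriv v z
      + (z - p) ^ 2 * deriv (deriv v) z := ⟨_, rfl⟩
  have cE : ContinuousAt E p := by rw [hE]; fun_prop
  have hcubic : ∀ᶠ z in 𝓝[≠] p, (2 * a - 2 * a ^ 3) + (z - p) * (-6 * a ^ 2 * S z + (z - p) *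
      (-6 * a * S z ^ 2 - 2 * (z - p) * S z ^ 3 + 2 * d * (z - p) + (z - p) ^ 2 * E z
        - α * (z - p) - z * (a + (z - p) * S z))) = 0 := by
    filter_upwards [deriv_deriv_laurent hv hw, hODE, hw, self_mem_nhdsWithin] with z h2 ho hz hzp
    have hne : z - p ≠ 0 := sub_ne_zero.mpr hzp
    have hwS : w z = (a + (z - p) * S z) / (z - p) := by
      rw [hz, hS, hT]
      field_simp
      ring
    have hE' : deriv (deriv w) z = (2 * a + 2 * d * (z - p) ^ 3 + (z - p) ^ 4 * E z)
        / (z - p) ^ 3 := by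
      rw [h2, hE]
      field_simp
      ring
    rw [hE', hwS] at ho
    field_simp at ho
    linear_combination ho
  obtain ⟨h0, hcubic⟩ := eq_zero_and_eventually_eq_zero_of_add_sub_mul (by fun_prop) hcubic
  have ha2 : a ^ 2 = 1 := mul_left_cancel₀ ha (by linear_combination -h0 / 2)
  have hb : b = 0 := by
    have h := eq_zero_and_eventually_eq_zero_of_add_sub_mul (c := -6 * b) (p := p)
      (R := fun z => -6 * T z + (-6 * a * S z ^ 2 - 2 * (z - p) * S z ^ 3 + 2 * d * (z - p)
        + (z - p) ^ 2 * E z - α * (z - p) - z * (a + (z - p) * S z))) (by fun_prop)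
      (hcubic.mono fun z hz => by
        have hSz : S z = b + (z - p) * T z := by rw [hS]
        linear_combination hz + 6 * S z * ha2 + 6 * hSz)
    linear_combination -h.1 / 6
  have hS' : ∀ z, S z = (z - p) * T z := fun z => by simp [hS, hb]
  have hT' : ∀ z, T z = c + (z - p) * (d + (z - p) * v z) := fun z => by rw [hT]
  obtain ⟨-, hlin⟩ := eq_zero_and_eventually_eq_zero_of_add_sub_mul (c := 0) (p := p)
    (R := fun z => -6 * T z + (-6 * a * ((z - p) * T z) ^ 2 - 2 * (z - p) * ((z - p) * T z) ^ 3
      + 2 * d * (z - p) + (z - p) ^ 2 * E z - α * (z - p) - z * (a + (z - p) * ((z - p) * T z))))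
    (by fun_prop) (hcubic.mono fun z hz => by
      rw [hS'] at hz
      linear_combination hz + 6 * (z - p) * T z * ha2)
  obtain ⟨hc, hconst⟩ := eq_zero_and_eventually_eq_zero_of_add_sub_mul (c := -6 * c - p * a)
    (p := p) (R := fun z => (-4 * d - α - a) + (z - p) * (-6 * v z - 6 * a * T z ^ 2
      - 2 * (z - p) ^ 2 * T z ^ 3 + E z - z * T z))
    (by fun_prop) (hlin.mono fun z hz => by linear_combination hz + 6 * hT' z)
  obtain ⟨hd, -⟩ := eq_zero_and_eventually_eq_zero_of_add_sub_mul (by fun_prop) hconst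
  exact ⟨by simpa using ha2, hb, by linear_combination -hc / 6,
    by linear_combination -hd / 4⟩

/-- Every pole of a solution of `[II_α]` is simple with residue `η = ±1`, and the regular
part `g = w − η/(z − p)` satisfies `g(p) = 0`, `g'(p) = −ηp/6`, `g''(p)/2 = −(α + η)/4`. -/
theorem painleveII_pole_laurent (α p : ℂ) (r : ℝ) (hr : 0 < r) (w : ℂ → ℂ)
    (hw : AnalyticOnNhd ℂ w (ball p r \ {p}))
    (hODE : ∀ z ∈ ball p r \ {p}, deriv (deriv w) z = α + z * w z + 2 * (w z) ^ 3)
    (hpole : Tendsto (fun z => ‖w z‖) (𝓝[≠] p) atTop) :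
    ∃ η : ℂ, (η = 1 ∨ η = -1) ∧ ∃ g : ℂ → ℂ,
      AnalyticOnNhd ℂ g (ball p r) ∧
      (∀ z ∈ ball p r \ {p}, g z = w z - η / (z - p)) ∧
      g p = 0 ∧ deriv g p = -η * p / 6 ∧ deriv (deriv g) p / 2 = -(α + η) / 4 := by
  have hmem : ∀ᶠ z in 𝓝[≠] p, z ∈ ball p r \ {p} :=
    sdiff_mem_nhdsWithin_compl (ball_mem_nhds p hr) _
  have hODE' := hmem.mono hODE
  have hmero : MeromorphicAt w p :=
    meromorphicAt_of_tendsto_norm_atTop (hmem.mono fun z hz => (hw z hz).differentiableAt) hpole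
  have horder := painleveII_meromorphicOrderAt hmero hODE'
    ((tendsto_cobounded_iff_meromorphicOrderAt_neg hmero).mp
      (tendsto_norm_atTop_iff_cobounded.mp hpole))
  obtain ⟨u, hu, hu0, hwu⟩ := (meromorphicOrderAt_eq_int_iff hmero).mp horder
  obtain ⟨u₁, hu₁, hu_eq⟩ := hu.exists_eq_add_sub_mul
  obtain ⟨u₂, hu₂, hu₁_eq⟩ := hu₁.exists_eq_add_sub_mul
  obtain ⟨u₃, hu₃, hu₂_eq⟩ := hu₂.exists_eq_add_sub_mul
  obtain ⟨v, hv, hu₃_eq⟩ := hu₃.exists_eq_add_sub_mul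
  set η := u p
  have hlaurent : ∀ᶠ z in 𝓝[≠] p, w z = η / (z - p) + (u₁ p + u₂ p * (z - p)
      + u₃ p * (z - p) ^ 2 + (z - p) ^ 3 * v z) := by
    filter_upwards [hwu, self_mem_nhdsWithin] with z hz hzp
    have hne : z - p ≠ 0 := sub_ne_zero.mpr hzp
    rw [hz, smul_eq_mul, zpow_neg_one, hu_eq z, hu₁_eq z, hu₂_eq z, hu₃_eq z]
    field_simp
    ring
  obtain ⟨hη, hb, hc, hd⟩ := painleveII_laurent_coeffs hu0 hv hODE' hlaurent
  set g : ℂ → ℂ := Function.update (fun z => w z - η / (z - p)) p 0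
  have hg : ∀ z ≠ p, g z = w z - η / (z - p) := fun z hz => Function.update_of_ne hz _ _
  have hgp : g p = 0 := Function.update_self _ _ _
  have hloc : g =ᶠ[𝓝 p] fun z => (z - p) * u₂ z := by
    have hpunct : ∀ᶠ z in 𝓝[≠] p, g z = (z - p) * u₂ z := by
      filter_upwards [hlaurent, self_mem_nhdsWithin] with z hz hzp
      rw [hg z hzp, hz, hb, hu₂_eq z, hu₃_eq z]
      ring
    rw [eventually_nhdsWithin_iff] at hpunct
    filter_upwards [hpunct] with z hz
    rcases eq_or_ne z p with rfl | hzp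
    · simp [hgp]
    · exact hz hzp
  have hderiv : deriv g =ᶠ[𝓝 p] fun z => u₂ z + (z - p) * deriv u₂ z := by
    filter_upwards [hloc.deriv, hu₂.eventually_analyticAt] with z hz hu₂z
    rw [hz]
    refine ((((hasDerivAt_id z).sub_const p).fun_mul
      hu₂z.differentiableAt.hasDerivAt).congr_deriv ?_).deriv
    simp
  have hu₂' : deriv u₂ p = u₃ p := by
    rw [funext hu₂_eq]
    refine (((((hasDerivAt_id p).sub_const p).fun_mul
      hu₃.differentiableAt.hasDerivAt).const_add _).congr_deriv ?_).deriv
    simp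
  refine ⟨η, hη, g, fun z hz => ?_, fun z hz => hg z hz.2, hgp, ?_, ?_⟩
  · rcases eq_or_ne z p with rfl | hzp
    · refine AnalyticAt.congr ?_ hloc.symm
      fun_prop
    · have hne : z - p ≠ 0 := sub_ne_zero.mpr hzp
      have hwz := hw z ⟨hz, hzp⟩
      have han : AnalyticAt ℂ (fun z => w z - η / (z - p)) z := by
        fun_prop (disch := assumption)
      refine han.congr ?_
      filter_upwards [isOpen_ne.mem_nhds hzp] with y hy using (hg y hy).symm
  · rw [hderiv.eq_of_nhds]
    simp [hc]
  · have h2 : deriv (deriv g) p = 2 * u₃ p := by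
      rw [hderiv.deriv_eq]
      refine ((hu₂.differentiableAt.hasDerivAt.fun_add (((hasDerivAt_id p).sub_const p).fun_mul
        hu₂.deriv.differentiableAt.hasDerivAt)).congr_deriv ?_).deriv
      rw [hu₂']
      simp
      ring
    rw [h2, ← hd]
    ring
end

section
/- Let α ∈ ℂ, p ∈ ℂ, and let w be analytic on a punctured disc D' = {z : 0 < |z − p| < r} solving [II_α] there, with a (necessarily simple) pole at p of residue η ∈ {1, −1}. Set V(z) := w'(z) + w(z)² + z/2 on D'. If η = 1, then V extends analytically to p with V(p) = 0. If η = −1, then V has a pole of order exactly 2 at p; more precisely (z − p)²·V(z) → 2 as z → p. -/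
open Filter Topology Metric

/-- Two functions continuous at `p` which agree on a punctured ball around `p` agree at `p`. -/
lemma eq_of_eqOn_punctured_ball {p : ℂ} {r : ℝ} (hr : 0 < r) {F G : ℂ → ℂ}
    (hF : ContinuousAt F p) (hG : ContinuousAt G p)
    (h : ∀ z ∈ ball p r \ {p}, F z = G z) : F p = G p := by
  have hev : F =ᶠ[𝓝[≠] p] G := by
    filter_upwards [sdiff_mem_nhdsWithin_compl (ball_mem_nhds p hr) {p}] with z hz using h z hz
  exact tendsto_nhds_unique_of_eventuallyEq (hF.tendsto.mono_left nhdsWithin_le_nhds)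
    (hG.tendsto.mono_left nhdsWithin_le_nhds) hev

lemma hasDerivAt_div_sub (a p z : ℂ) (hz : z ≠ p) :
    HasDerivAt (fun x => a / (x - p)) (-a / (z - p) ^ 2) z := by
  have hz' : z - p ≠ 0 := sub_ne_zero.mpr hz
  simpa using (hasDerivAt_const z a).fun_div ((hasDerivAt_id z).sub_const p) hz'

lemma hasDerivAt_div_sub_sq (a p z : ℂ) (hz : z ≠ p) :
    HasDerivAt (fun x => -a / (x - p) ^ 2) (2 * a / (z - p) ^ 3) z := by
  have hz' : z - p ≠ 0 := sub_ne_zero.mpr hz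
  have h := (hasDerivAt_const z (-a)).fun_div (((hasDerivAt_id z).sub_const p).fun_pow 2)
    (pow_ne_zero 2 hz')
  refine h.congr_deriv ?_
  simp only [id]
  field_simp
  push_cast
  ring

/-- At a pole of `w` with residue `η`, the function `V = w' + w² + z/2` extends
analytically with `V(p) = 0` if `η = 1`, and has a pole of order exactly two with
`(z − p)²·V(z) → 2` if `η = −1`. -/
theorem painleveII_V_at_pole (α p : ℂ) (r : ℝ) (hr : 0 < r) (w : ℂ → ℂ)
    (hw : AnalyticOnNhd ℂ w (ball p r \ {p}))
    (hODE : ∀ z ∈ ball p r \ {p}, deriv (deriv w) z = α + z * w z + 2 * (w z) ^ 3)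
    (η : ℂ) (hη : η = 1 ∨ η = -1)
    (g : ℂ → ℂ) (hg : AnalyticOnNhd ℂ g (ball p r))
    (hwg : ∀ z ∈ ball p r \ {p}, w z = η / (z - p) + g z) :
    (η = 1 → ∃ V₀ : ℂ → ℂ, AnalyticOnNhd ℂ V₀ (ball p r) ∧
        (∀ z ∈ ball p r \ {p}, V₀ z = deriv w z + (w z) ^ 2 + z / 2) ∧ V₀ p = 0) ∧
    (η = -1 → Tendsto (fun z => (z - p) ^ 2 * (deriv w z + (w z) ^ 2 + z / 2))
        (𝓝[≠] p) (𝓝 2)) := by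
  have hp : p ∈ ball p r := mem_ball_self hr
  have hopen : IsOpen (ball p r \ {p}) := isOpen_ball.sdiff isClosed_singleton
  have hη2 : η ^ 2 = 1 := by rcases hη with rfl | rfl <;> norm_num
  have hw1 : ∀ z ∈ ball p r \ {p}, deriv w z = -η / (z - p) ^ 2 + deriv g z := by
    intro z hz
    have hev : w =ᶠ[𝓝 z] fun x => η / (x - p) + g x :=
      eventually_of_mem (hopen.mem_nhds hz) hwg
    rw [hev.deriv_eq]
    exact ((hasDerivAt_div_sub η p z hz.2).fun_add
      (hg z hz.1).differentiableAt.hasDerivAt).deriv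
  have hw2 : ∀ z ∈ ball p r \ {p},
      deriv (deriv w) z = 2 * η / (z - p) ^ 3 + deriv (deriv g) z := by
    intro z hz
    have hev : deriv w =ᶠ[𝓝 z] fun x => -η / (x - p) ^ 2 + deriv g x :=
      eventually_of_mem (hopen.mem_nhds hz) hw1
    rw [hev.deriv_eq]
    exact ((hasDerivAt_div_sub_sq η p z hz.2).fun_add
      (hg.deriv z hz.1).differentiableAt.hasDerivAt).deriv
  have cg : ContinuousAt g p := (hg p hp).continuousAt
  have cg1 : ContinuousAt (deriv g) p := (hg.deriv p hp).continuousAt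
  have cg2 : ContinuousAt (deriv (deriv g)) p := (hg.deriv.deriv p hp).continuousAt
  have hmain : ∀ z ∈ ball p r \ {p}, (z - p) ^ 2 * deriv (deriv g) z =
      (z - p) ^ 2 * (α + z * g z + 2 * g z ^ 3) + (z - p) * (z * η + 6 * η * g z ^ 2)
        + 6 * g z := by
    intro z hz
    have hz' : z - p ≠ 0 := sub_ne_zero.mpr hz.2
    have h := hODE z hz
    rw [hw2 z hz, hwg z hz] at h
    field_simp at h
    refine mul_left_cancel₀ hz' ?_
    linear_combination h + (2 * η + 6 * g z * (z - p)) * hη2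
  constructor
  · rintro rfl
    have hgp : g p = 0 := by
      have h := eq_of_eqOn_punctured_ball hr (by fun_prop) (by fun_prop) hmain
      simpa using h
    have hd : AnalyticOnNhd ℂ (dslope g p) (ball p r) :=
      ((Complex.differentiableOn_dslope (ball_mem_nhds p hr)).2
        hg.differentiableOn).analyticOnNhd isOpen_ball
    have cd : ContinuousAt (dslope g p) p := (hd p hp).continuousAt
    have hgd : ∀ z, g z = (z - p) * dslope g p z := by
      intro z
      have h := sub_smul_dslope g p z
      simpa [hgp] using h.symm
    have hd6 : deriv g p = -p / 6 := by
      have h := eq_of_eqOn_punctured_ball (p := p) hr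
        (F := fun z => (z - p) * deriv (deriv g) z)
        (G := fun z => (z - p) * (α + z * g z + 2 * g z ^ 3) + (z * 1 + 6 * 1 * g z ^ 2)
          + 6 * dslope g p z) (by fun_prop) (by fun_prop) (fun z hz => by
            refine mul_left_cancel₀ (sub_ne_zero.mpr hz.2) ?_
            linear_combination hmain z hz + 6 * hgd z)
      simp [hgp, dslope_same] at h
      linear_combination -h / 6
    refine ⟨fun z => deriv g z + 2 * dslope g p z + g z ^ 2 + z / 2, ?_, ?_, ?_⟩
    · intro z hz
      have h0 := hg z hz
      have h1 := hg.deriv z hz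
      have h2 := hd z hz
      fun_prop
    · intro z hz
      have hz' : z - p ≠ 0 := sub_ne_zero.mpr hz.2
      have h : dslope g p z = g z / (z - p) := by rw [hgd z]; field_simp
      simp only [hw1 z hz, hwg z hz, h]
      field_simp
      ring
    · simp only [dslope_same, hgp, hd6]
      ring
  · rintro rfl
    have hc : ContinuousAt (fun z => 2 + (z - p) ^ 2 * deriv g z - 2 * (z - p) * g z
        + (z - p) ^ 2 * g z ^ 2 + (z - p) ^ 2 * (z / 2)) p := by fun_prop
    have ht := hc.tendsto.mono_left (nhdsWithin_le_nhds (s := {p}ᶜ))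
    simp only [sub_self, ne_eq, OfNat.ofNat_ne_zero, not_false_eq_true, zero_pow, zero_mul,
      mul_zero, add_zero, sub_zero] at ht
    refine ht.congr' ?_
    filter_upwards [sdiff_mem_nhdsWithin_compl (ball_mem_nhds p hr) {p}] with z hz
    have hz' : z - p ≠ 0 := sub_ne_zero.mpr hz.2
    rw [hw1 z hz, hwg z hz]
    field_simp
    ring
end

section
/- Let α ∈ ℂ, p ∈ ℂ, and let w be analytic on a punctured disc D' = {z : 0 < |z − p| < r} solving [II_α] there, with a pole at p. Then the first integral W(z) := w(z)⁴ + z·w(z)² + 2α·w(z) − w'(z)² has a simple pole at p with residue −1; that is, z ↦ W(z) + 1/(z − p) extends analytically to the full disc {z : |z − p| < r}. -/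
open Filter Topology Metric

/-- A punctured disc in the complex plane is preconnected. -/
theorem isPreconnected_ball_diff_center (p : ℂ) (r : ℝ) :
    IsPreconnected (ball p r \ {p}) := by
  have himage : ball p r \ {p} =
      (fun x : ℝ × ℂ => p + x.1 * x.2) '' (Set.Ioo 0 r ×ˢ sphere 0 1) := by
    ext z
    simp only [Set.mem_sdiff, mem_ball, Set.mem_singleton_iff, Set.mem_image, Set.mem_prod,
      Set.mem_Ioo, mem_sphere_zero_iff_norm, Prod.exists]
    constructor
    · rintro ⟨hzr, hzp⟩
      have hnorm : 0 < ‖z - p‖ := norm_pos_iff.2 (sub_ne_zero.2 hzp)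
      have hne : (‖z - p‖ : ℂ) ≠ 0 := by exact_mod_cast hnorm.ne'
      refine ⟨‖z - p‖, (z - p) / ‖z - p‖, ⟨⟨hnorm, by rwa [← dist_eq_norm]⟩, ?_⟩, ?_⟩
      · simp [hnorm.ne']
      · field_simp
        ring
    · rintro ⟨s, e, ⟨⟨hs, hsr⟩, he⟩, rfl⟩
      have hene : e ≠ 0 := norm_ne_zero_iff.1 (by simp [he])
      refine ⟨by simpa [dist_eq_norm, he, abs_of_pos hs] using hsr, ?_⟩
      simp [hs.ne', hene]
  rw [himage]
  exact (isPreconnected_Ioo.prod (isPreconnected_sphere (by simp) 0 1)).image _ (by fun_prop)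

/-- The reciprocal of a function with a pole at `p` extends analytically by `0` to `p`. -/
theorem analyticAt_update_inv_of_tendsto_norm_atTop {w : ℂ → ℂ} {p : ℂ}
    (hw : ∀ᶠ z in 𝓝[≠] p, AnalyticAt ℂ w z)
    (hpole : Tendsto (fun z => ‖w z‖) (𝓝[≠] p) atTop) :
    AnalyticAt ℂ (Function.update w⁻¹ p 0) p := by
  refine Complex.analyticAt_of_differentiable_on_punctured_nhds_of_continuousAt ?_ ?_
  · filter_upwards [hw, hpole.eventually_gt_atTop 0, self_mem_nhdsWithin] with z hz hpos hzp
    refine (hz.inv (norm_pos_iff.1 hpos)).differentiableAt.congr_of_eventuallyEq ?_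
    filter_upwards [isOpen_ne.mem_nhds hzp] with y hy
    exact Function.update_of_ne hy _ _
  · rw [continuousAt_update_same, tendsto_zero_iff_norm_tendsto_zero]
    simpa [Function.comp_def] using tendsto_inv_atTop_zero.comp hpole

/-- The equation satisfied by the reciprocal `u` of a solution of the second Painlevé equation. -/
theorem reciprocal_painleveII {α z : ℂ} {u w : ℂ → ℂ} (hu : AnalyticAt ℂ u z) (huz : u z ≠ 0)
    (huw : w =ᶠ[𝓝 z] u⁻¹)
    (hODE : deriv (deriv w) z = α + z * w z + 2 * (w z) ^ 3) :
    u z * deriv (deriv u) z =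
      2 * (deriv u z) ^ 2 - 2 - z * (u z) ^ 2 - α * (u z) ^ 3 := by
  have hderiv : deriv w =ᶠ[𝓝 z] fun y => -deriv u y / (u y) ^ 2 := by
    filter_upwards [huw.eventuallyEq_nhds, hu.eventually_analyticAt,
      hu.continuousAt.eventually_ne huz] with y hy huy huy0
    rw [hy.deriv_eq, deriv_inv'' huy.differentiableAt huy0]
  have hderiv2 : deriv (deriv w) z =
      -deriv (deriv u) z / (u z) ^ 2 + 2 * (deriv u z) ^ 2 / (u z) ^ 3 := by
    rw [hderiv.deriv_eq]
    have h := (hu.deriv.differentiableAt.hasDerivAt.neg).div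
      (hu.differentiableAt.hasDerivAt.pow 2) (pow_ne_zero 2 huz)
    refine (h.deriv).trans ?_
    simp
    field_simp
  rw [hderiv2, huw.eq_of_nhds] at hODE
  simp only [Pi.inv_apply] at hODE
  field_simp at hODE
  linear_combination -hODE

/-- A function `u` with `u p = 0` satisfying the reciprocal Painlevé II equation near `p` has
`u' p = ±1` and `u'' p = 0`. -/
theorem deriv_sq_eq_one_and_deriv_deriv_eq_zero {α p : ℂ} {u : ℂ → ℂ} (hu : AnalyticAt ℂ u p)
    (hup : u p = 0)
    (hODE : ∀ᶠ z in 𝓝[≠] p, u z * deriv (deriv u) z =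
      2 * (deriv u z) ^ 2 - 2 - z * (u z) ^ 2 - α * (u z) ^ 3) :
    (deriv u p) ^ 2 = 1 ∧ deriv (deriv u) p = 0 := by
  have hu1 := hu.deriv
  have hu2 := hu1.deriv
  have heq : (fun z => u z * deriv (deriv u) z) =ᶠ[𝓝 p]
      fun z => 2 * (deriv u z) ^ 2 - 2 - z * (u z) ^ 2 - α * (u z) ^ 3 :=
    (ContinuousAt.eventuallyEq_nhds_iff_eventuallyEq_nhdsNE
      (by fun_prop) (by fun_prop)).1 hODE
  have hsq : (deriv u p) ^ 2 = 1 := by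
    have h := heq.eq_of_nhds
    simp only [hup] at h
    linear_combination -h / 2
  refine ⟨hsq, ?_⟩
  have d0 := hu.differentiableAt.hasDerivAt
  have d1 := hu1.differentiableAt.hasDerivAt
  have d2 := hu2.differentiableAt.hasDerivAt
  have hl := (d0.mul d2).deriv
  have hr := (((((d1.pow 2).const_mul 2).sub_const 2).sub
    ((hasDerivAt_id p).mul (d0.pow 2))).sub ((d0.pow 3).const_mul α)).deriv
  have h := hl.symm.trans (heq.deriv_eq.trans hr)
  simp [hup] at h
  have hne : deriv u p ≠ 0 := by
    intro h0
    simp [h0] at hsq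
  have : 3 * deriv u p * deriv (deriv u) p = 0 := by linear_combination -h
  simpa [hne] using this

/-- If `u` vanishes at `p` with `u' p = ±1` and `u'' p = 0`, then `1 / u² - 1 / (z - p)²` is
analytic at `p`. -/
theorem exists_analyticAt_eq_inv_sq_sub {p : ℂ} {u : ℂ → ℂ} (hu : AnalyticAt ℂ u p)
    (hup : u p = 0) (hsq : (deriv u p) ^ 2 = 1) (hu2 : deriv (deriv u) p = 0) :
    ∃ h : ℂ → ℂ, AnalyticAt ℂ h p ∧
      ∀ᶠ z in 𝓝[≠] p, h z = (u z ^ 2)⁻¹ - ((z - p) ^ 2)⁻¹ := by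
  set c := deriv u p
  obtain ⟨k, hk, huk⟩ : ∃ k : ℂ → ℂ, AnalyticAt ℂ k p ∧
      ∀ᶠ z in 𝓝 p, u z = (z - p) * (c + (z - p) ^ 2 * k z) := by
    have hf : AnalyticAt ℂ (fun z => u z - c * (z - p)) p := by fun_prop
    have hderiv : deriv (fun z => u z - c * (z - p)) =ᶠ[𝓝 p] fun z => deriv u z - c := by
      filter_upwards [hu.eventually_analyticAt] with z hz
      have h := hz.differentiableAt.hasDerivAt.fun_sub
        (((hasDerivAt_id' z).sub_const p).const_mul c)
      simpa using h.deriv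
    have horder : ((3 : ℕ) : ℕ∞) ≤ analyticOrderAt (fun z => u z - c * (z - p)) p := by
      rw [natCast_le_analyticOrderAt_iff_iteratedDeriv_eq_zero hf]
      intro i hi
      interval_cases i
      · simp [hup]
      · simp [iteratedDeriv_one, hderiv.eq_of_nhds, c]
      · simp [iteratedDeriv_succ, iteratedDeriv_zero, hderiv.deriv_eq, hu2]
    obtain ⟨k, hk, hfk⟩ := (natCast_le_analyticOrderAt hf).1 horder
    refine ⟨k, hk, hfk.mono fun z hz => ?_⟩
    rw [smul_eq_mul] at hz
    linear_combination hz
  have hc : c ≠ 0 := by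
    intro h0
    simp [h0] at hsq
  have hv : AnalyticAt ℂ (fun z => c + (z - p) ^ 2 * k z) p := by fun_prop
  have hvp : c + (p - p) ^ 2 * k p ≠ 0 := by simpa using hc
  refine ⟨fun z => -(2 * c * k z + (z - p) ^ 2 * k z ^ 2) / (c + (z - p) ^ 2 * k z) ^ 2,
    AnalyticAt.div (by fun_prop) (hv.pow 2) (pow_ne_zero 2 hvp), ?_⟩
  filter_upwards [huk.filter_mono nhdsWithin_le_nhds,
    (hv.continuousAt.eventually_ne hvp).filter_mono nhdsWithin_le_nhds,
    self_mem_nhdsWithin] with z hz hvz hzp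
  have ht : z - p ≠ 0 := sub_ne_zero.2 hzp
  rw [hz]
  generalize hv_def : c + (z - p) ^ 2 * k z = v at hvz
  field_simp
  rw [← hv_def]
  linear_combination hsq

/-- A function on a punctured disc whose derivative extends analytically across the centre extends
analytically across the centre. -/
theorem exists_analyticOnNhd_ball_of_deriv {p : ℂ} {r : ℝ} {G h : ℂ → ℂ}
    (hh : AnalyticOnNhd ℂ h (ball p r))
    (hG : ∀ z ∈ ball p r \ {p}, HasDerivAt G (h z) z) :
    ∃ F : ℂ → ℂ, AnalyticOnNhd ℂ F (ball p r) ∧ ∀ z ∈ ball p r \ {p}, F z = G z := by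
  obtain ⟨H, hH⟩ := hh.differentiableOn.isExactOn_ball
  have hopen : IsOpen (ball p r \ {p}) := isOpen_ball.sdiff isClosed_singleton
  have hd : ∀ z ∈ ball p r \ {p}, HasDerivAt (fun y => G y - H y) 0 z := fun z hz => by
    simpa using (hG z hz).fun_sub (hH z hz.1)
  obtain ⟨a, ha⟩ := hopen.exists_is_const_of_deriv_eq_zero
    (isPreconnected_ball_diff_center p r)
    (fun z hz => (hd z hz).differentiableAt.differentiableWithinAt)
    (fun z hz => (hd z hz).deriv)
  refine ⟨fun z => H z + a, ?_, fun z hz => ?_⟩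
  · refine DifferentiableOn.analyticOnNhd (fun z hz => ?_) isOpen_ball
    exact ((hH z hz).differentiableAt.add_const a).differentiableWithinAt
  · rw [← ha z hz]
    ring

/-- The first integral `W = w⁴ + z·w² + 2α·w − w'²` of a solution of `[II_α]` satisfies
`W' = w²`. -/
theorem hasDerivAt_painleveII_first_integral {α z : ℂ} {w : ℂ → ℂ} (hw : AnalyticAt ℂ w z)
    (hODE : deriv (deriv w) z = α + z * w z + 2 * (w z) ^ 3) :
    HasDerivAt (fun z => (w z) ^ 4 + z * (w z) ^ 2 + 2 * α * w z - (deriv w z) ^ 2)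
      ((w z) ^ 2) z := by
  have d0 := hw.differentiableAt.hasDerivAt
  have d1 := hw.deriv.differentiableAt.hasDerivAt
  refine ((((d0.fun_pow 4).fun_add ((hasDerivAt_id' z).fun_mul (d0.fun_pow 2))).fun_add
    (d0.const_mul (2 * α))).fun_sub (d1.fun_pow 2)).congr_deriv ?_
  simp [hODE]
  ring

/-- At a pole `p` of a solution `w` of `[II_α]`, the first integral
`W = w⁴ + z·w² + 2α·w − w'²` has a simple pole with residue `−1`:
`W(z) + 1/(z − p)` extends analytically to the full disc. -/
theorem painleveII_first_integral_pole (α p : ℂ) (r : ℝ) (hr : 0 < r) (w : ℂ → ℂ)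
    (hw : AnalyticOnNhd ℂ w (ball p r \ {p}))
    (hODE : ∀ z ∈ ball p r \ {p}, deriv (deriv w) z = α + z * w z + 2 * (w z) ^ 3)
    (hpole : Tendsto (fun z => ‖w z‖) (𝓝[≠] p) atTop) :
    ∃ F : ℂ → ℂ, AnalyticOnNhd ℂ F (ball p r) ∧
      ∀ z ∈ ball p r \ {p},
        F z = ((w z) ^ 4 + z * (w z) ^ 2 + 2 * α * w z - (deriv w z) ^ 2) + 1 / (z - p) := by
  have hmem : ∀ᶠ z in 𝓝[≠] p, z ∈ ball p r \ {p} :=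
    sdiff_mem_nhdsWithin_compl (ball_mem_nhds p hr) {p}
  have hopen : IsOpen (ball p r \ {p}) := isOpen_ball.sdiff isClosed_singleton
  set u : ℂ → ℂ := Function.update w⁻¹ p 0
  have hu : AnalyticAt ℂ u p :=
    analyticAt_update_inv_of_tendsto_norm_atTop (hmem.mono fun z hz => hw z hz) hpole
  have hup : u p = 0 := Function.update_self ..
  have huw : ∀ z ≠ p, u z = (w z)⁻¹ := fun z hz => Function.update_of_ne hz _ _
  have huODE : ∀ᶠ z in 𝓝[≠] p, u z * deriv (deriv u) z =
      2 * (deriv u z) ^ 2 - 2 - z * (u z) ^ 2 - α * (u z) ^ 3 := by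
    filter_upwards [hmem, hpole.eventually_gt_atTop 0,
      hu.eventually_analyticAt.filter_mono nhdsWithin_le_nhds] with z hz hpos huz
    refine reciprocal_painleveII huz ?_ ?_ (hODE z hz)
    · rw [huw z hz.2]
      exact inv_ne_zero (norm_pos_iff.1 hpos)
    · filter_upwards [hopen.mem_nhds hz] with y hy
      simp [huw y hy.2]
  obtain ⟨hsq, hu2⟩ := deriv_sq_eq_one_and_deriv_deriv_eq_zero hu hup huODE
  obtain ⟨h, hh, heq⟩ := exists_analyticAt_eq_inv_sq_sub hu hup hsq hu2
  set g : ℂ → ℂ := Function.update (fun z => w z ^ 2 - ((z - p) ^ 2)⁻¹) p (h p) with hg_def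
  have hgw : ∀ z ≠ p, g z = w z ^ 2 - ((z - p) ^ 2)⁻¹ := fun z hz => Function.update_of_ne hz _ _
  have hg : AnalyticOnNhd ℂ g (ball p r) := by
    intro z hz
    by_cases hzp : z = p
    · subst hzp
      refine hh.congr (eventuallyEq_nhds_of_eventuallyEq_nhdsNE ?_ (by simp [hg_def]))
      filter_upwards [heq, self_mem_nhdsWithin] with y hy hyz
      rw [hy, hgw y hyz, huw y hyz, inv_pow, inv_inv]
    · have ht : (z - p) ^ 2 ≠ 0 := pow_ne_zero 2 (sub_ne_zero.2 hzp)
      have hwz := hw z ⟨hz, hzp⟩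
      have : AnalyticAt ℂ (fun z => w z ^ 2 - ((z - p) ^ 2)⁻¹) z := by
        fun_prop (disch := assumption)
      refine this.congr ?_
      filter_upwards [isOpen_ne.mem_nhds hzp] with y hy
      exact (hgw y hy).symm
  refine exists_analyticOnNhd_ball_of_deriv hg fun z hz => ?_
  have ht : z - p ≠ 0 := sub_ne_zero.2 hz.2
  rw [hgw z hz.2, sub_eq_add_neg]
  refine (hasDerivAt_painleveII_first_integral (hw z hz) (hODE z hz)).fun_add ?_
  simpa [neg_div] using ((hasDerivAt_id' z).sub_const p).fun_inv ht
end

section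
/- Let −π ≤ a < b ≤ π, let S = {z ∈ ℂ : z ≠ 0, a < arg z < b}, let λ ∈ ℝ, and let f be analytic on S with |f(z)| ≤ C·|z|^λ for all z ∈ S and some constant C > 0. Then for every δ with 0 < δ < (b − a)/2 and every k ∈ ℕ there is a constant C' > 0 such that |f^{(k)}(z)| ≤ C'·|z|^{λ−k} for all z in the smaller sector S(δ) = {z ≠ 0 : a + δ < arg z < b − δ}. -/
open Complex

/-- On `[1/2, 2]`, the function `t ↦ t ^ s` is bounded by `2 ^ |s|`. -/
lemma Real.rpow_le_two_rpow_abs {t : ℝ} (ht₁ : 1 / 2 ≤ t) (ht₂ : t ≤ 2) (s : ℝ) :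
    t ^ s ≤ 2 ^ |s| := by
  have ht : 0 < t := by linarith
  rcases le_total 0 s with hs | hs
  · rw [abs_of_nonneg hs]
    exact Real.rpow_le_rpow ht.le ht₂ hs
  · rw [abs_of_nonpos hs, Real.rpow_neg zero_le_two, ← Real.inv_rpow zero_le_two]
    exact Real.rpow_le_rpow_of_nonpos (by norm_num) (by linarith) hs

/-- Points close to `1` have small argument. -/
lemma Complex.exists_forall_norm_sub_one_le_abs_arg_lt {δ : ℝ} (hδ : 0 < δ) :
    ∃ ε : ℝ, 0 < ε ∧ ε ≤ 1 / 2 ∧ ∀ u : ℂ, ‖u - 1‖ ≤ ε → |arg u| < δ := by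
  obtain ⟨η, hη, h⟩ := Metric.continuousAt_iff.1 (continuousAt_arg one_mem_slitPlane) δ hδ
  refine ⟨min (η / 2) (1 / 2), by positivity, min_le_right _ _, fun u hu => ?_⟩
  have hdist : dist u 1 < η := by
    rw [dist_eq_norm]
    linarith [min_le_left (η / 2) (1 / 2)]
  simpa [Real.dist_eq] using h hdist

/-- A Cauchy-estimate in sectors: if `f` is analytic on a sector `S` with
`|f(z)| = O(|z|^λ)`, then `f⁽ᵏ⁾(z) = O(|z|^{λ−k})` on every smaller sector. -/
theorem deriv_growth_in_sector (a b : ℝ) (ha : -Real.pi ≤ a) (hab : a < b)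
    (hb : b ≤ Real.pi) (lam : ℝ) (C : ℝ) (hC : 0 < C) (f : ℂ → ℂ)
    (hf : AnalyticOnNhd ℂ f {z : ℂ | z ≠ 0 ∧ a < arg z ∧ arg z < b})
    (hbound : ∀ z : ℂ, z ≠ 0 → a < arg z → arg z < b → ‖f z‖ ≤ C * ‖z‖ ^ lam) :
    ∀ δ : ℝ, 0 < δ → δ < (b - a) / 2 → ∀ k : ℕ, ∃ C' : ℝ, 0 < C' ∧
      ∀ z : ℂ, z ≠ 0 → a + δ < arg z → arg z < b - δ →
        ‖iteratedDeriv k f z‖ ≤ C' * ‖z‖ ^ (lam - k) := by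
  intro δ hδ _ k
  obtain ⟨ε, hε, hε', harg⟩ := exists_forall_norm_sub_one_le_abs_arg_lt hδ
  refine ⟨k.factorial * (C * 2 ^ |lam|) / ε ^ k, by positivity, fun z hz haz hbz => ?_⟩
  have hz' : 0 < ‖z‖ := norm_pos_iff.2 hz
  have hball : ∀ w ∈ Metric.closedBall z (ε * ‖z‖),
      (w ≠ 0 ∧ a < arg w ∧ arg w < b) ∧ ‖w‖ ^ lam ≤ 2 ^ |lam| * ‖z‖ ^ lam := by
    intro w hw
    obtain ⟨u, rfl⟩ : ∃ u, w = z * u := ⟨w / z, by field_simp⟩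
    have hu : ‖u - 1‖ ≤ ε := by
      rw [mem_closedBall_iff_norm, show z * u - z = (u - 1) * z by ring, norm_mul] at hw
      exact le_of_mul_le_mul_right hw hz'
    have hnorm : |‖u‖ - 1| ≤ ε := by
      simpa using (abs_norm_sub_norm_le u 1).trans hu
    rw [abs_le] at hnorm
    have hu₀ : u ≠ 0 := norm_pos_iff.1 (by linarith)
    have hargu := abs_lt.1 (harg u hu)
    have hmul : arg (z * u) = arg z + arg u :=
      (arg_mul_eq_add_arg_iff hz hu₀).2 ⟨by linarith, by linarith⟩
    refine ⟨⟨mul_ne_zero hz hu₀, by linarith, by linarith⟩, ?_⟩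
    rw [norm_mul, Real.mul_rpow hz'.le (norm_nonneg u), mul_comm]
    gcongr
    exact Real.rpow_le_two_rpow_abs (by linarith) (by linarith) lam
  have hdiff : DiffContOnCl ℂ f (Metric.ball z (ε * ‖z‖)) :=
    DifferentiableOn.diffContOnCl fun w hw =>
      (hf w (hball w (Metric.closure_ball_subset_closedBall hw)).1).differentiableWithinAt
  have hsphere : ∀ w ∈ Metric.sphere z (ε * ‖z‖), ‖f w‖ ≤ C * (2 ^ |lam| * ‖z‖ ^ lam) := by
    intro w hw
    obtain ⟨⟨hw₀, haw, hbw⟩, hle⟩ := hball w (Metric.sphere_subset_closedBall hw)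
    exact (hbound w hw₀ haw hbw).trans (by gcongr)
  refine (norm_iteratedDeriv_le_of_forall_mem_sphere_norm_le k (by positivity)
    hdiff hsphere).trans_eq ?_
  rw [Real.rpow_sub hz', Real.rpow_natCast, mul_pow]
  field_simp
end

section
/- Let (c_k)_{k≥1} be a sequence in ℂ with 0 < |c_1| ≤ |c_2| ≤ … and |c_k| → ∞, whose counting function n(r) := #{k : |c_k| ≤ r} satisfies n(r) ≤ A·r^ϱ for all r > 0, where ϱ = h + γ with h a nonnegative integer and 0 < γ < 1. Let κ > 0. Then there is a constant B > 0 such that for every z ∈ ℂ with |z| ≥ |c_1| satisfying |z − c_k| ≥ κ·max{|z|, |c_k|} for all k, one has Σ_{k=1}^{∞} |z|^h / (|z − c_k|·|c_k|^h) ≤ B·|z|^{ϱ−1}. -/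
open Filter Topology

/-- Discrete comparison of `(x + 1) ^ (p - 1)` with the increment of `x ^ p`, `0 ≤ p ≤ 1`. -/
lemma mul_rpow_sub_one_le_rpow_sub {p x : ℝ} (hp0 : 0 ≤ p) (hp1 : p ≤ 1) (hx : 0 ≤ x) :
    p * (x + 1) ^ (p - 1) ≤ (x + 1) ^ p - x ^ p := by
  have hx1 : 0 < x + 1 := by linarith
  have hb : (1 + -(1 / (x + 1))) ^ p ≤ 1 + p * -(1 / (x + 1)) :=
    rpow_one_add_le_one_add_mul_self
      (by rw [neg_le_neg_iff, div_le_one hx1]; linarith) hp0 hp1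
  have he : 1 + -(1 / (x + 1)) = x / (x + 1) := by field_simp; ring
  rw [he, Real.div_rpow hx hx1.le, div_le_iff₀ (by positivity)] at hb
  rw [Real.rpow_sub_one hx1.ne']
  calc p * ((x + 1) ^ p / (x + 1))
      = (x + 1) ^ p - (1 + p * -(1 / (x + 1))) * (x + 1) ^ p := by ring
    _ ≤ _ := by linarith

/-- Discrete comparison of `(x + 1) ^ (p - 1)` with the increment of `x ^ p`, `p ≤ 0`. -/
lemma neg_mul_rpow_sub_one_le_rpow_sub {p x : ℝ} (hp : p ≤ 0) (hx : 0 < x) :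
    -p * (x + 1) ^ (p - 1) ≤ x ^ p - (x + 1) ^ p := by
  have hx1 : 0 < x + 1 := by linarith
  have he : 1 + -(1 / (x + 1)) = x / (x + 1) := by field_simp; ring
  have hb : 1 + p * -(1 / (x + 1)) ≤ (1 + -(1 / (x + 1))) ^ p := by
    have hy : 0 < 1 + -(1 / (x + 1)) := by rw [he]; positivity
    rw [Real.rpow_def_of_pos hy]
    nlinarith [Real.add_one_le_exp (Real.log (1 + -(1 / (x + 1))) * p),
      Real.log_le_sub_one_of_pos hy]
  rw [he, Real.div_rpow hx.le hx1.le, le_div_iff₀ (by positivity)] at hb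
  rw [Real.rpow_sub_one hx1.ne']
  calc -p * ((x + 1) ^ p / (x + 1))
      = (1 + p * -(1 / (x + 1))) * (x + 1) ^ p - (x + 1) ^ p := by ring
    _ ≤ _ := by linarith

lemma sum_range_rpow_sub_one_le {p : ℝ} (hp0 : 0 < p) (hp1 : p ≤ 1) (N : ℕ) :
    ∑ k ∈ Finset.range N, ((k : ℝ) + 1) ^ (p - 1) ≤ (N : ℝ) ^ p / p := by
  rw [le_div_iff₀' hp0, Finset.mul_sum]
  calc ∑ k ∈ Finset.range N, p * ((k : ℝ) + 1) ^ (p - 1)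
      ≤ ∑ k ∈ Finset.range N, (((k + 1 : ℕ) : ℝ) ^ p - (k : ℝ) ^ p) := by
        refine Finset.sum_le_sum fun k _ => ?_
        push_cast
        exact mul_rpow_sub_one_le_rpow_sub hp0.le hp1 k.cast_nonneg
    _ = (N : ℝ) ^ p := by
        rw [Finset.sum_range_sub fun k : ℕ => (k : ℝ) ^ p]
        simp [Real.zero_rpow hp0.ne']

lemma sum_range_add_rpow_sub_one_le {p : ℝ} (hp : p < 0) {N : ℕ} (hN : 0 < N) (M : ℕ) :
    ∑ k ∈ Finset.range M, (((N + k : ℕ) : ℝ) + 1) ^ (p - 1) ≤ (N : ℝ) ^ p / (-p) := by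
  rw [le_div_iff₀' (neg_pos.2 hp), Finset.mul_sum]
  calc ∑ k ∈ Finset.range M, -p * (((N + k : ℕ) : ℝ) + 1) ^ (p - 1)
      ≤ ∑ k ∈ Finset.range M, (((N + k : ℕ) : ℝ) ^ p - ((N + (k + 1) : ℕ) : ℝ) ^ p) := by
        refine Finset.sum_le_sum fun k _ => ?_
        have hpos : (0 : ℝ) < ((N + k : ℕ) : ℝ) := by exact_mod_cast Nat.add_pos_left hN k
        have := neg_mul_rpow_sub_one_le_rpow_sub hp.le hpos
        rwa [show ((N + (k + 1) : ℕ) : ℝ) = ((N + k : ℕ) : ℝ) + 1 by push_cast; ring]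
    _ ≤ (N : ℝ) ^ p := by
        rw [Finset.sum_range_sub' fun k : ℕ => ((N + k : ℕ) : ℝ) ^ p]
        have : 0 ≤ ((N + M : ℕ) : ℝ) ^ p := by positivity
        simpa using this

/-- A monotone sequence tending to infinity has at least `k + 1` terms bounded by its `k`-th. -/
lemma succ_le_card_le_of_monotone {a : ℕ → ℝ} (hmono : Monotone a)
    (htop : Tendsto a atTop atTop) (k : ℕ) : k + 1 ≤ Nat.card {j : ℕ | a j ≤ a k} := by
  have hfin : {j : ℕ | a j ≤ a k}.Finite := by
    obtain ⟨n, hn⟩ := (htop.eventually_gt_atTop (a k)).exists_forall_of_atTop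
    refine (Set.finite_lt_nat n).subset fun j hj => ?_
    by_contra hlt
    exact absurd (hn j (not_lt.1 hlt)) (not_lt.2 hj)
  rw [Nat.card_coe_set_eq]
  calc k + 1 = ((Finset.range (k + 1) : Finset ℕ) : Set ℕ).ncard := by
        rw [Set.ncard_coe_finset, Finset.card_range]
    _ ≤ _ := by
        refine Set.ncard_le_ncard (fun j hj => ?_) hfin
        simp only [Finset.coe_range, Set.mem_Iio] at hj
        exact hmono (by omega)

lemma inv_pow_le_of_le_mul_rpow {x A a ϱ : ℝ} (hx : 0 < x) (hA : 0 < A) (ha : 0 < a)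
    (hϱ : 0 < ϱ) (hle : x ≤ A * a ^ ϱ) (m : ℕ) :
    (a ^ m)⁻¹ ≤ A ^ (m / ϱ) * x ^ (-(m / ϱ)) := by
  have h1 : (x / A) ^ (m / ϱ) ≤ a ^ m := by
    calc (x / A) ^ (m / ϱ) ≤ (a ^ ϱ) ^ (m / ϱ) :=
          Real.rpow_le_rpow (by positivity) (by rwa [div_le_iff₀' hA]) (by positivity)
      _ = a ^ m := by
          rw [← Real.rpow_mul ha.le, mul_div_cancel₀ _ hϱ.ne', Real.rpow_natCast]
  calc (a ^ m)⁻¹ ≤ ((x / A) ^ (m / ϱ))⁻¹ := inv_anti₀ (by positivity) h1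
    _ = _ := by
        rw [Real.div_rpow hx.le hA.le, inv_div, Real.rpow_neg hx.le, div_eq_mul_inv]

/-- Lemma 4: if the counting function of `(c_k)` satisfies `n(r) ≤ A·r^ϱ`,
`ϱ = h + γ`, `0 < γ < 1`, then for points `z` staying `κ`-away from all `c_k`,
`Σ_k |z|^h/(|z − c_k|·|c_k|^h) = O(|z|^{ϱ−1})`. -/
theorem sum_over_sequence_estimate (c : ℕ → ℂ) (hc0 : 0 < ‖c 0‖)
    (hmono : Monotone fun k => ‖c k‖)
    (htop : Tendsto (fun k => ‖c k‖) atTop atTop)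
    (h : ℕ) (γ : ℝ) (hγ0 : 0 < γ) (hγ1 : γ < 1) (ϱ : ℝ) (hϱ : ϱ = h + γ)
    (A : ℝ) (hA : 0 < A)
    (hcount : ∀ r : ℝ, 0 < r → (Nat.card {k : ℕ | ‖c k‖ ≤ r} : ℝ) ≤ A * r ^ ϱ)
    (κ : ℝ) (hκ : 0 < κ) :
    ∃ B : ℝ, 0 < B ∧ ∀ z : ℂ, ‖c 0‖ ≤ ‖z‖ →
      (∀ k : ℕ, κ * max ‖z‖ ‖c k‖ ≤ ‖z - c k‖) →
      Summable (fun k => ‖z‖ ^ h / (‖z - c k‖ * ‖c k‖ ^ h)) ∧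
      ∑' k : ℕ, ‖z‖ ^ h / (‖z - c k‖ * ‖c k‖ ^ h) ≤ B * ‖z‖ ^ (ϱ - 1) := by
  have hϱ0 : 0 < ϱ := by rw [hϱ]; positivity
  have hpos : ∀ k, 0 < ‖c k‖ := fun k => hc0.trans_le (hmono (Nat.zero_le k))
  have hgrow : ∀ k : ℕ, (k : ℝ) + 1 ≤ A * ‖c k‖ ^ ϱ := fun k =>
    le_trans (by exact_mod_cast succ_le_card_le_of_monotone hmono htop k) (hcount _ (hpos k))
  -- the exponents governing the head and the tail of the sum
  obtain ⟨p, hp⟩ : ∃ p : ℝ, p = γ / ϱ := ⟨_, rfl⟩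
  obtain ⟨q, hq⟩ : ∃ q : ℝ, q = (γ - 1) / ϱ := ⟨_, rfl⟩
  have hp0 : 0 < p := by rw [hp]; positivity
  have hp1 : p ≤ 1 := by
    rw [hp, div_le_one hϱ0, hϱ]
    linarith [(Nat.cast_nonneg h : (0 : ℝ) ≤ h)]
  have hq0 : q < 0 := by rw [hq]; exact div_neg_of_neg_of_pos (by linarith) hϱ0
  have hph : -((h : ℕ) / ϱ) = p - 1 := by rw [hp]; field_simp; rw [hϱ]; ring
  have hqh : -(((h + 1 : ℕ) : ℝ) / ϱ) = q - 1 := by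
    rw [hq]; field_simp; rw [hϱ]; push_cast; ring
  obtain ⟨C, hC⟩ : ∃ C : ℝ, C = A ^ ((h : ℕ) / ϱ) / κ := ⟨_, rfl⟩
  obtain ⟨D, hD⟩ : ∃ D : ℝ, D = A ^ (((h + 1 : ℕ) : ℝ) / ϱ) / κ := ⟨_, rfl⟩
  have hC0 : 0 < C := by rw [hC]; positivity
  have hD0 : 0 < D := by rw [hD]; positivity
  have hq0' : 0 < -q := neg_pos.2 hq0
  refine ⟨C * (A ^ p / p) + D * ((A / 2) ^ q / (-q)), by positivity, fun z hz hsep => ?_⟩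
  obtain ⟨R, hR⟩ : ∃ R : ℝ, R = ‖z‖ := ⟨_, rfl⟩
  rw [← hR] at hz hsep ⊢
  have hR0 : 0 < R := hc0.trans_le hz
  have hhead : ∀ k : ℕ, R ^ h / (‖z - c k‖ * ‖c k‖ ^ h)
      ≤ C * R ^ (h - 1 : ℝ) * ((k : ℝ) + 1) ^ (p - 1) := fun k => by
    have hk := hpos k
    have hinv := inv_pow_le_of_le_mul_rpow (by positivity) hA hk hϱ0 (hgrow k) h
    rw [hph] at hinv
    calc R ^ h / (‖z - c k‖ * ‖c k‖ ^ h) ≤ R ^ h / (κ * R * ‖c k‖ ^ h) := by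
          gcongr
          exact (mul_le_mul_of_nonneg_left (le_max_left _ _) hκ.le).trans (hsep k)
      _ = κ⁻¹ * (R ^ h / R) * (‖c k‖ ^ h)⁻¹ := by field_simp
      _ ≤ κ⁻¹ * (R ^ h / R) * (A ^ ((h : ℕ) / ϱ) * ((k : ℝ) + 1) ^ (p - 1)) := by gcongr
      _ = _ := by rw [hC, Real.rpow_sub_one hR0.ne', Real.rpow_natCast]; ring
  have htail : ∀ k : ℕ, R ^ h / (‖z - c k‖ * ‖c k‖ ^ h)
      ≤ D * R ^ h * ((k : ℝ) + 1) ^ (q - 1) := fun k => by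
    have hk := hpos k
    have hinv := inv_pow_le_of_le_mul_rpow (by positivity) hA hk hϱ0 (hgrow k) (h + 1)
    rw [hqh] at hinv
    calc R ^ h / (‖z - c k‖ * ‖c k‖ ^ h) ≤ R ^ h / (κ * ‖c k‖ * ‖c k‖ ^ h) := by
          gcongr
          exact (mul_le_mul_of_nonneg_left (le_max_right _ _) hκ.le).trans (hsep k)
      _ = κ⁻¹ * R ^ h * (‖c k‖ ^ (h + 1))⁻¹ := by rw [pow_succ']; field_simp
      _ ≤ κ⁻¹ * R ^ h * (A ^ (((h + 1 : ℕ) : ℝ) / ϱ) * ((k : ℝ) + 1) ^ (q - 1)) := by gcongr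
      _ = _ := by rw [hD]; ring
  have hX1 : 1 ≤ A * R ^ ϱ := by
    have h0 := hgrow 0
    rw [Nat.cast_zero, zero_add] at h0
    exact h0.trans (by gcongr)
  -- the cut-off index
  obtain ⟨N, hN⟩ : ∃ N : ℕ, N = ⌊A * R ^ ϱ⌋₊ := ⟨_, rfl⟩
  have hN0 : 0 < N := by rw [hN]; exact Nat.floor_pos.2 hX1
  have hNle : (N : ℝ) ≤ A * R ^ ϱ := by rw [hN]; exact Nat.floor_le (by positivity)
  have hNge : A / 2 * R ^ ϱ ≤ N := by
    have h1 : A * R ^ ϱ < N + 1 := by rw [hN]; exact Nat.lt_floor_add_one _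
    have h2 : (1 : ℝ) ≤ N := by exact_mod_cast hN0
    linarith
  have hNp : (N : ℝ) ^ p ≤ A ^ p * R ^ γ := by
    calc (N : ℝ) ^ p ≤ (A * R ^ ϱ) ^ p := Real.rpow_le_rpow N.cast_nonneg hNle hp0.le
      _ = _ := by
        rw [Real.mul_rpow hA.le (by positivity), ← Real.rpow_mul hR0.le, hp,
          mul_div_cancel₀ _ hϱ0.ne']
  have hNq : (N : ℝ) ^ q ≤ (A / 2) ^ q * R ^ (γ - 1) := by
    calc (N : ℝ) ^ q ≤ (A / 2 * R ^ ϱ) ^ q :=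
          Real.rpow_le_rpow_of_nonpos (by positivity) hNge hq0.le
      _ = _ := by
        rw [Real.mul_rpow (by positivity) (by positivity), ← Real.rpow_mul hR0.le, hq,
          mul_div_cancel₀ _ hϱ0.ne']
  have hnonneg : ∀ k : ℕ, 0 ≤ R ^ h / (‖z - c k‖ * ‖c k‖ ^ h) := fun k => by positivity
  have hbound : ∀ M : ℕ, ∑ k ∈ Finset.range M, R ^ h / (‖z - c k‖ * ‖c k‖ ^ h)
      ≤ (C * (A ^ p / p) + D * ((A / 2) ^ q / (-q))) * R ^ (ϱ - 1) := fun M => by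
    calc ∑ k ∈ Finset.range M, R ^ h / (‖z - c k‖ * ‖c k‖ ^ h)
        ≤ ∑ k ∈ Finset.range (N + M), R ^ h / (‖z - c k‖ * ‖c k‖ ^ h) :=
          Finset.sum_le_sum_of_subset_of_nonneg
            (Finset.range_subset_range.2 (Nat.le_add_left M N)) fun k _ _ => hnonneg k
      _ ≤ ∑ k ∈ Finset.range N, C * R ^ (h - 1 : ℝ) * ((k : ℝ) + 1) ^ (p - 1)
          + ∑ k ∈ Finset.range M, D * R ^ h * (((N + k : ℕ) : ℝ) + 1) ^ (q - 1) := by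
          rw [Finset.sum_range_add]
          exact add_le_add (Finset.sum_le_sum fun k _ => hhead k)
            (Finset.sum_le_sum fun k _ => htail (N + k))
      _ ≤ C * R ^ (h - 1 : ℝ) * ((N : ℝ) ^ p / p) + D * R ^ h * ((N : ℝ) ^ q / (-q)) := by
          rw [← Finset.mul_sum, ← Finset.mul_sum]
          gcongr
          · exact sum_range_rpow_sub_one_le hp0 hp1 N
          · exact sum_range_add_rpow_sub_one_le hq0 hN0 M
      _ ≤ C * R ^ (h - 1 : ℝ) * (A ^ p * R ^ γ / p)
          + D * R ^ (h : ℝ) * ((A / 2) ^ q * R ^ (γ - 1) / (-q)) := by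
          rw [Real.rpow_natCast]
          gcongr
      _ = C * (A ^ p / p) * (R ^ (h - 1 : ℝ) * R ^ γ)
          + D * ((A / 2) ^ q / (-q)) * (R ^ (h : ℝ) * R ^ (γ - 1)) := by ring
      _ = _ := by
          rw [← Real.rpow_add hR0, ← Real.rpow_add hR0,
            show (h - 1 : ℝ) + γ = ϱ - 1 by rw [hϱ]; ring,
            show (h : ℝ) + (γ - 1) = ϱ - 1 by rw [hϱ]; ring]
          ring
  exact ⟨summable_of_sum_range_le hnonneg hbound, Real.tsum_le_of_sum_range_le hnonneg hbound⟩
end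

section
/- Let (p_k)_{k≥0} be a sequence in ℂ with Re p_k → ∞ and arg p_k → 0, satisfying p_{k+1} = p_k + √2·π·p_k^{−1/2} + o(|p_k|^{−1/2}) as k → ∞, where p_k^{−1/2} is the principal branch. Then p_k^{3/2} = (3√2·π/2)·k·(1 + o(1)) as k → ∞ (principal branch); in particular |p_k| ~ ((3√2·π/2)·k)^{2/3}, and the counting function n(r) := #{k : |p_k| ≤ r} satisfies n(r) = (√2/(3π))·r^{3/2}·(1 + o(1)) as r → ∞. -/
open Filter Topology Real

/-- If `a k / k → A > 0`, then the counting function of `a` satisfies `n(s) / s → 1 / A`. -/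
theorem tendsto_ncard_le_div {a : ℕ → ℝ} {A : ℝ} (hA : 0 < A)
    (ha : Tendsto (fun k : ℕ => a k / k) atTop (𝓝 A)) :
    Tendsto (fun s : ℝ => ({k : ℕ | a k ≤ s}.ncard : ℝ) / s) atTop (𝓝 A⁻¹) := by
  have hsmall (C : ℝ) : Tendsto (fun s : ℝ => C / s) atTop (𝓝 0) :=
    tendsto_const_nhds.div_atTop tendsto_id
  have hupper (B : ℝ) (hB : 0 < B) (hBA : B < A) :
      ∃ K : ℕ, ∀ s : ℝ, 0 < s → {k : ℕ | a k ≤ s} ⊆ Set.Iio (K + 1 + ⌊s / B⌋₊) := by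
    obtain ⟨K, hK⟩ := eventually_atTop.1 (ha.eventually (lt_mem_nhds hBA))
    refine ⟨K, fun s hs k (hk : a k ≤ s) => ?_⟩
    rw [Set.mem_Iio]
    by_contra! hlt
    have h1 := hK k (by omega)
    have hk0 : (0 : ℝ) < k := by
      have : 0 < k := by omega
      exact_mod_cast this
    rw [lt_div_iff₀ hk0] at h1
    have h2 : (k : ℝ) ≤ s / B := by
      rw [le_div_iff₀ hB]
      linarith
    have := Nat.le_floor h2
    omega
  rw [tendsto_order]
  constructor
  · intro u hu
    obtain ⟨v, huv, hv⟩ := exists_between (max_lt hu (inv_pos.2 hA))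
    have hv0 : 0 < v := lt_of_le_of_lt (le_max_right _ _) huv
    have huv' : u < v := lt_of_le_of_lt (le_max_left _ _) huv
    have hB : A < v⁻¹ := (lt_inv_comm₀ hv0 hA).1 hv
    obtain ⟨K, hK⟩ := eventually_atTop.1 (ha.eventually (gt_mem_nhds hB))
    obtain ⟨K', hK'⟩ := hupper (A / 2) (by positivity) (by linarith)
    have hlim : Tendsto (fun s : ℝ => v - (K + 1) / s) atTop (𝓝 (v - 0)) :=
      tendsto_const_nhds.sub (hsmall _)
    rw [sub_zero] at hlim
    filter_upwards [hlim.eventually (lt_mem_nhds huv'), eventually_gt_atTop 0] with s hs hs0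
    refine hs.trans_le ?_
    have hsub : (Finset.Ico (K + 1) (⌊v * s⌋₊ + 1) : Set ℕ) ⊆ {k : ℕ | a k ≤ s} := by
      intro k hk
      rw [Finset.mem_coe, Finset.mem_Ico] at hk
      have h1 := hK k (by omega)
      have hk0 : (0 : ℝ) < k := by
        have : 0 < k := by omega
        exact_mod_cast this
      rw [div_lt_iff₀ hk0] at h1
      have h2 : (k : ℝ) ≤ v * s := (Nat.le_floor_iff (by positivity)).1 (by omega)
      have h3 : v⁻¹ * k ≤ s := by
        rw [inv_mul_le_iff₀ hv0]
        exact h2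
      exact h1.le.trans h3
    have hcard := Set.ncard_le_ncard hsub ((Set.finite_Iio _).subset (hK' s hs0))
    rw [Set.ncard_coe_finset, Nat.card_Ico] at hcard
    have h4 : v * s < ⌊v * s⌋₊ + 1 := Nat.lt_floor_add_one _
    have h5 : (⌊v * s⌋₊ : ℝ) + 1 ≤ {k : ℕ | a k ≤ s}.ncard + (K + 1) := by
      have : ⌊v * s⌋₊ + 1 ≤ {k : ℕ | a k ≤ s}.ncard + (K + 1) := by omega
      exact_mod_cast this
    rw [le_div_iff₀ hs0, sub_mul, div_mul_cancel₀ _ hs0.ne']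
    linarith
  · intro u hu
    obtain ⟨v, hv, hvu⟩ := exists_between hu
    have hv0 : 0 < v := (inv_pos.2 hA).trans hv
    obtain ⟨K, hK⟩ := hupper v⁻¹ (inv_pos.2 hv0) ((inv_lt_comm₀ hA hv0).1 hv)
    have hlim : Tendsto (fun s : ℝ => v + (K + 1) / s) atTop (𝓝 (v + 0)) :=
      tendsto_const_nhds.add (hsmall _)
    rw [add_zero] at hlim
    filter_upwards [hlim.eventually (gt_mem_nhds hvu), eventually_gt_atTop 0] with s hs hs0
    refine lt_of_le_of_lt ?_ hs
    have hcard := Set.ncard_le_ncard (hK s hs0) (Set.finite_Iio _)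
    rw [← Finset.coe_Iio, Set.ncard_coe_finset, Nat.card_Iio] at hcard
    have h1 : (({k : ℕ | a k ≤ s}.ncard : ℕ) : ℝ) ≤ K + 1 + ⌊s / v⁻¹⌋₊ := by
      exact_mod_cast hcard
    have h2 : (⌊s / v⁻¹⌋₊ : ℝ) ≤ s / v⁻¹ := Nat.floor_le (by positivity)
    rw [div_inv_eq_mul] at h1 h2
    rw [div_le_iff₀ hs0, add_mul, div_mul_cancel₀ _ hs0.ne']
    linarith

/-- If the consecutive differences of `u` converge to `l`, then `u k / k → l`. -/
theorem tendsto_div_natCast_of_tendsto_sub {u : ℕ → ℂ} {l : ℂ}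
    (h : Tendsto (fun k => u (k + 1) - u k) atTop (𝓝 l)) :
    Tendsto (fun k : ℕ => u k / (k : ℂ)) atTop (𝓝 l) := by
  have h1 := h.cesaro_smul
  have h2 : Tendsto (fun k : ℕ => u 0 / (k : ℂ)) atTop (𝓝 0) :=
    tendsto_const_div_atTop_nhds_zero_nat _
  have h3 := h1.add h2
  rw [add_zero] at h3
  refine h3.congr fun k => ?_
  rw [Finset.sum_range_sub, Complex.real_smul]
  push_cast
  ring

/-- If `w k * δ k → c` and `δ k → 0`, then `w k * ((1 + δ k) ^ s - 1) → c * s`. -/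
theorem tendsto_mul_one_add_cpow_sub_one {w δ : ℕ → ℂ} {c : ℂ} (s : ℂ)
    (hδ : Tendsto δ atTop (𝓝 0)) (hw : Tendsto (fun k => w k * δ k) atTop (𝓝 c)) :
    Tendsto (fun k => w k * ((1 + δ k) ^ s - 1)) atTop (𝓝 (c * s)) := by
  have hd : HasDerivAt (fun z : ℂ => (1 + z) ^ s) s 0 := by
    have := ((hasDerivAt_id (0 : ℂ)).const_add 1).cpow_const (c := s) (by simp)
    simpa using this
  have hc := (continuousAt_dslope_same.2 hd.differentiableAt).tendsto
  rw [dslope_same, hd.deriv] at hc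
  refine (hw.mul (hc.comp hδ)).congr fun k => ?_
  have := sub_smul_dslope (fun z : ℂ => (1 + z) ^ s) 0 (δ k)
  simp only [sub_zero, smul_eq_mul, add_zero, Complex.one_cpow] at this
  rw [← this, Function.comp_apply, mul_assoc]

/-- Principal powers are multiplicative on the right half-plane. -/
theorem mul_cpow_of_re_pos {x y : ℂ} (hx : 0 < x.re) (hy : 0 < y.re) (s : ℂ) :
    (x * y) ^ s = x ^ s * y ^ s := by
  have hx0 : x ≠ 0 := by rintro rfl; simp at hx
  have hy0 : y ≠ 0 := by rintro rfl; simp at hy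
  have h1 := abs_lt.1 (Complex.abs_arg_lt_pi_div_two_iff.2 (Or.inl hx))
  have h2 := abs_lt.1 (Complex.abs_arg_lt_pi_div_two_iff.2 (Or.inl hy))
  have hlog : Complex.log (x * y) = Complex.log x + Complex.log y :=
    Complex.log_mul hx0 hy0 ⟨by linarith, by linarith⟩
  rw [Complex.cpow_def_of_ne_zero (mul_ne_zero hx0 hy0), Complex.cpow_def_of_ne_zero hx0,
    Complex.cpow_def_of_ne_zero hy0, hlog, add_mul, Complex.exp_add]

/-- If `p (k + 1) = p k + c * p k ^ (-1/2) + o(|p k| ^ (-1/2))` and `Re (p k) → ∞`, then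
the consecutive differences of `p k ^ (3/2)` converge to `3 * c / 2`. -/
theorem tendsto_cpow_three_halves_sub {p e : ℕ → ℂ} {c : ℂ}
    (hre : Tendsto (fun k => (p k).re) atTop atTop)
    (hrec : ∀ k, p (k + 1) = p k + c * p k ^ (-(1 / 2) : ℂ) + e k)
    (he : Tendsto (fun k => ‖e k‖ * ‖p k‖ ^ ((1 : ℝ) / 2)) atTop (𝓝 0)) :
    Tendsto (fun k => p (k + 1) ^ ((3 : ℂ) / 2) - p k ^ ((3 : ℂ) / 2)) atTop
      (𝓝 (c * (3 / 2))) := by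
  have hpos : ∀ᶠ k in atTop, 0 < (p k).re := hre.eventually_gt_atTop 0
  have hne : ∀ᶠ k in atTop, p k ≠ 0 := by
    filter_upwards [hpos] with k hk h
    simp [h] at hk
  have hnorm : Tendsto (fun k => ‖p k‖) atTop atTop :=
    tendsto_atTop_mono (fun k => Complex.re_le_norm _) hre
  set δ : ℕ → ℂ := fun k => p (k + 1) / p k - 1 with hδdef
  have herr : Tendsto (fun k => p k ^ ((1 : ℂ) / 2) * e k) atTop (𝓝 0) := by
    rw [tendsto_zero_iff_norm_tendsto_zero]
    refine he.congr fun k => ?_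
    rw [norm_mul, mul_comm, ← Complex.norm_cpow_real]
    norm_num
  have hw : Tendsto (fun k => p k ^ ((3 : ℂ) / 2) * δ k) atTop (𝓝 c) := by
    have h := herr.const_add c
    rw [add_zero] at h
    refine h.congr' ?_
    filter_upwards [hne] with k hk
    have h32 : p k ^ ((3 : ℂ) / 2) = p k ^ ((1 : ℂ) / 2) * p k := by
      rw [show (3 : ℂ) / 2 = 1 / 2 + 1 by norm_num, Complex.cpow_add _ _ hk, Complex.cpow_one]
    have h0 : p k ^ ((1 : ℂ) / 2) ≠ 0 := by simp [Complex.cpow_eq_zero_iff, hk]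
    simp only [hδdef]
    rw [hrec k, h32, Complex.cpow_neg]
    field_simp
    ring
  have hδ : Tendsto δ atTop (𝓝 0) := by
    have hinv : Tendsto (fun k => (p k ^ ((3 : ℂ) / 2))⁻¹) atTop (𝓝 0) := by
      rw [tendsto_zero_iff_norm_tendsto_zero]
      have := ((tendsto_rpow_atTop (y := (3 : ℝ) / 2) (by norm_num)).comp hnorm).inv_tendsto_atTop
      refine this.congr fun k => ?_
      rw [Pi.inv_apply, Function.comp_apply, norm_inv, ← Complex.norm_cpow_real]
      norm_num
    have h := hinv.mul hw
    rw [zero_mul] at h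
    refine h.congr' ?_
    filter_upwards [hne] with k hk
    have h0 : p k ^ ((3 : ℂ) / 2) ≠ 0 := by simp [Complex.cpow_eq_zero_iff, hk]
    rw [inv_mul_cancel_left₀ h0]
  have hre1 : ∀ᶠ k in atTop, 0 < (1 + δ k).re := by
    have h : Tendsto (fun k => (1 + δ k).re) atTop (𝓝 (1 + 0 : ℂ).re) :=
      (Complex.continuous_re.tendsto _).comp (hδ.const_add 1)
    exact h.eventually (lt_mem_nhds (by simp))
  refine (tendsto_mul_one_add_cpow_sub_one (3 / 2) hδ hw).congr' ?_
  filter_upwards [hpos, hne, hre1] with k hk hk0 hk1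
  have : p (k + 1) = p k * (1 + δ k) := by
    simp only [hδdef]
    field_simp
    ring
  rw [this, mul_cpow_of_re_pos hk hk1]
  ring

/-- Asymptotics of a string of poles of the first kind: if
`p_{k+1} = p_k + √2·π·p_k^{−1/2} + o(|p_k|^{−1/2})` with `Re p_k → ∞`, `arg p_k → 0`,
then `p_k^{3/2} ~ (3√2π/2)·k`, `|p_k| ~ ((3√2π/2)k)^{2/3}`, and the counting function
satisfies `n(r) ~ (√2/(3π))·r^{3/2}`. -/
theorem string_counting_asymptotics (p : ℕ → ℂ)
    (hre : Tendsto (fun k => (p k).re) atTop atTop)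
    (harg : Tendsto (fun k => Complex.arg (p k)) atTop (𝓝 0))
    (hrec : ∃ e : ℕ → ℂ,
      (∀ k, p (k + 1) = p k + (Real.sqrt 2 * Real.pi : ℂ) * p k ^ (-(1 / 2) : ℂ) + e k) ∧
      Tendsto (fun k => ‖e k‖ * ‖p k‖ ^ ((1 : ℝ) / 2)) atTop (𝓝 0)) :
    Tendsto (fun k : ℕ => p k ^ ((3 : ℂ) / 2) / (k : ℂ)) atTop
      (𝓝 ((3 * Real.sqrt 2 * Real.pi / 2 : ℝ) : ℂ)) ∧
    Tendsto (fun k : ℕ => ‖p k‖ / (3 * Real.sqrt 2 * Real.pi / 2 * k) ^ ((2 : ℝ) / 3))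
      atTop (𝓝 1) ∧
    Tendsto (fun r : ℝ => (Nat.card {k : ℕ | ‖p k‖ ≤ r} : ℝ) / r ^ ((3 : ℝ) / 2))
      atTop (𝓝 (Real.sqrt 2 / (3 * Real.pi))) := by
  obtain ⟨e, hrec, he⟩ := hrec
  set A : ℝ := 3 * Real.sqrt 2 * Real.pi / 2 with hAdef
  have hA : 0 < A := by positivity
  have hmain : Tendsto (fun k : ℕ => p k ^ ((3 : ℂ) / 2) / (k : ℂ)) atTop (𝓝 (A : ℂ)) := by
    have h := tendsto_div_natCast_of_tendsto_sub (u := fun k => p k ^ ((3 : ℂ) / 2))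
      (tendsto_cpow_three_halves_sub hre hrec he)
    convert h using 2
    rw [hAdef]
    push_cast
    ring
  have habs : Tendsto (fun k : ℕ => ‖p k‖ ^ ((3 : ℝ) / 2) / k) atTop (𝓝 A) := by
    have h := hmain.norm
    rw [Complex.norm_real, Real.norm_of_nonneg hA.le] at h
    refine h.congr fun k => ?_
    rw [norm_div, Complex.norm_natCast, ← Complex.norm_cpow_real]
    norm_num
  refine ⟨hmain, ?_, ?_⟩
  · have h := (habs.div_const A).rpow_const (p := (2 : ℝ) / 3) (Or.inr (by norm_num))
    rw [div_self hA.ne', Real.one_rpow] at h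
    refine h.congr fun k => ?_
    rw [div_div, mul_comm (k : ℝ) A, Real.div_rpow (by positivity) (by positivity),
      ← Real.rpow_mul (norm_nonneg _)]
    norm_num
  · have h := (tendsto_ncard_le_div hA habs).comp
      (tendsto_rpow_atTop (y := (3 : ℝ) / 2) (by norm_num))
    have hAinv : A⁻¹ = Real.sqrt 2 / (3 * Real.pi) := by
      have h2 : Real.sqrt 2 * Real.sqrt 2 = 2 := Real.mul_self_sqrt (by norm_num)
      rw [hAdef, inv_eq_one_div, div_eq_div_iff (by positivity) (by positivity)]
      linear_combination (-(3 * Real.pi / 2)) * h2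
    rw [hAinv] at h
    refine h.congr' ?_
    filter_upwards [eventually_ge_atTop 0] with r hr
    rw [Function.comp_apply, Nat.card_coe_set_eq]
    simp only [Real.rpow_le_rpow_iff (norm_nonneg _) hr (show (0 : ℝ) < 3 / 2 by norm_num)]
end

section
/- Let α, β ∈ ℂ, let U ⊆ ℂ be open, and let w be analytic and nonvanishing on U satisfying Painlevé IV: 2·w·w'' = w'² + 3w⁴ + 8z·w³ + 4(z² − α)·w² + 2β on U. Define W(z) := (w(z)⁴ + 4z·w(z)³ + 4(z² − α)·w(z)² − 2β − w'(z)²)/(4·w(z)). Then for all z ∈ U: W'(z) = w(z)² + 2z·w(z) and w''(z) = 2w(z)³ + 6z·w(z)² + 4(z² − α)·w(z) − 2W(z). -/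
/-- The first integral of Painlevé IV: for a nonvanishing solution of `[IV_{α,β}]`,
`W := (w⁴ + 4z·w³ + 4(z² − α)·w² − 2β − w'²)/(4w)` satisfies `W' = w² + 2z·w`
and `w'' = 2w³ + 6z·w² + 4(z² − α)·w − 2W`. -/
theorem painleveIV_first_integral (α β : ℂ) (U : Set ℂ) (hU : IsOpen U)
    (w : ℂ → ℂ) (hw : AnalyticOnNhd ℂ w U) (hw0 : ∀ z ∈ U, w z ≠ 0)
    (hODE : ∀ z ∈ U, 2 * w z * deriv (deriv w) z =
      (deriv w z) ^ 2 + 3 * (w z) ^ 4 + 8 * z * (w z) ^ 3 +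
        4 * (z ^ 2 - α) * (w z) ^ 2 + 2 * β)
    (W : ℂ → ℂ)
    (hW : W = fun z => ((w z) ^ 4 + 4 * z * (w z) ^ 3 + 4 * (z ^ 2 - α) * (w z) ^ 2
      - 2 * β - (deriv w z) ^ 2) / (4 * w z)) :
    ∀ z ∈ U, deriv W z = (w z) ^ 2 + 2 * z * w z ∧
      deriv (deriv w) z =
        2 * (w z) ^ 3 + 6 * z * (w z) ^ 2 + 4 * (z ^ 2 - α) * w z - 2 * W z := by
  intro z hz
  have hne : w z ≠ 0 := hw0 z hz
  have h4w : 4 * w z ≠ 0 := mul_ne_zero (by norm_num) hne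
  have hode := hODE z hz
  have hw₁ : HasDerivAt w (deriv w z) z := (hw z hz).differentiableAt.hasDerivAt
  have hw₂ : HasDerivAt (deriv w) (deriv (deriv w) z) z :=
    (hw z hz).deriv.differentiableAt.hasDerivAt
  have hid : HasDerivAt (fun x : ℂ => x) 1 z := hasDerivAt_id' z
  subst hW
  constructor
  · have hderiv := (((((hw₁.fun_pow 4).fun_add ((hid.const_mul 4).fun_mul (hw₁.fun_pow 3))).fun_add
      ((((hid.fun_pow 2).sub_const α).const_mul 4).fun_mul (hw₁.fun_pow 2))).sub_const
      (2 * β)).fun_sub (hw₂.fun_pow 2)).fun_div (hw₁.const_mul 4)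
      h4w
    rw [hderiv.deriv, div_eq_iff (pow_ne_zero 2 h4w)]
    push_cast
    linear_combination (-4 * deriv w z) * hode
  · beta_reduce
    field_simp
    linear_combination 2 * hode
end

section
/- Let U ⊆ ℂ be a connected open set and let 𝔴 be analytic and nonvanishing on U satisfying 2·𝔴·𝔴'' = 𝔴'² + 3𝔴⁴ + 8𝔴³ + 4𝔴² on U. Then the function (𝔴'² − 𝔴⁴ − 4𝔴³ − 4𝔴²)/𝔴 is constant on U; that is, there is c ∈ ℂ with 𝔴'² = 𝔴⁴ + 4𝔴³ + 4𝔴² + 4c·𝔴 on U. -/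
/-- For a nonvanishing solution of the re-scaled Painlevé IV equation
`2𝔴𝔴'' = 𝔴'² + 3𝔴⁴ + 8𝔴³ + 4𝔴²` on a connected open set, the function
`(𝔴'² − 𝔴⁴ − 4𝔴³ − 4𝔴²)/𝔴` is constant, i.e. `𝔴'² = 𝔴⁴ + 4𝔴³ + 4𝔴² + 4c𝔴`. -/
theorem rescaled_painleveIV_first_integral (U : Set ℂ) (hU : IsOpen U)
    (hUc : IsConnected U) (w : ℂ → ℂ) (hw : AnalyticOnNhd ℂ w U)
    (hw0 : ∀ z ∈ U, w z ≠ 0)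
    (hODE : ∀ z ∈ U, 2 * w z * deriv (deriv w) z =
      (deriv w z) ^ 2 + 3 * (w z) ^ 4 + 8 * (w z) ^ 3 + 4 * (w z) ^ 2) :
    ∃ c : ℂ, ∀ z ∈ U,
      (deriv w z) ^ 2 = (w z) ^ 4 + 4 * (w z) ^ 3 + 4 * (w z) ^ 2 + 4 * c * w z := by
  have hF : ∀ z ∈ U, HasDerivAt
      (fun z ↦ ((deriv w z) ^ 2 - (w z) ^ 4 - 4 * (w z) ^ 3 - 4 * (w z) ^ 2) / w z) 0 z := by
    intro z hz
    have h₁ : HasDerivAt w (deriv w z) z := (hw z hz).differentiableAt.hasDerivAt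
    have h₂ : HasDerivAt (deriv w) (deriv (deriv w) z) z :=
      (hw z hz).deriv.differentiableAt.hasDerivAt
    refine (((((h₂.fun_pow 2).fun_sub (h₁.fun_pow 4)).fun_sub
      ((h₁.fun_pow 3).const_mul 4)).fun_sub ((h₁.fun_pow 2).const_mul 4)).fun_div h₁
      (hw0 z hz)).congr_deriv ?_
    rw [div_eq_zero_iff]
    left
    push_cast
    linear_combination deriv w z * hODE z hz
  obtain ⟨a, ha⟩ := hU.exists_is_const_of_deriv_eq_zero hUc.isPreconnected
    (fun z hz ↦ (hF z hz).differentiableAt.differentiableWithinAt) (fun z hz ↦ (hF z hz).deriv)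
  refine ⟨a / 4, fun z hz ↦ ?_⟩
  have h := (div_eq_iff (hw0 z hz)).mp (ha z hz)
  linear_combination h
end

section
/- Let α ∈ ℂ, ε ∈ {1, −1}, let U ⊆ ℂ be open, and let w be analytic on U satisfying the Weber–Hermite equation w'(z) = −2 + ε·(w(z)² + 2z·w(z) − 2α) for all z ∈ U. Then w solves Painlevé IV with parameters α and β = −2(1 + εα)², i.e. 2·w·w'' = w'² + 3w⁴ + 8z·w³ + 4(z² − α)·w² + 2β on U. -/
/-- Solutions of the Weber–Hermite equation `w' = −2 + ε(w² + 2zw − 2α)`, `ε = ±1`,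
solve Painlevé IV with parameters `α` and `β = −2(1 + εα)²`. -/
theorem weberHermite_solves_painleveIV (α ε : ℂ) (hε : ε = 1 ∨ ε = -1)
    (U : Set ℂ) (hU : IsOpen U) (w : ℂ → ℂ) (hw : AnalyticOnNhd ℂ w U)
    (hWH : ∀ z ∈ U, deriv w z = -2 + ε * ((w z) ^ 2 + 2 * z * w z - 2 * α))
    (β : ℂ) (hβ : β = -2 * (1 + ε * α) ^ 2) :
    ∀ z ∈ U, 2 * w z * deriv (deriv w) z =
      (deriv w z) ^ 2 + 3 * (w z) ^ 4 + 8 * z * (w z) ^ 3 +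
        4 * (z ^ 2 - α) * (w z) ^ 2 + 2 * β := by
  intro z hz
  have hw' : HasDerivAt w (deriv w z) z := (hw z hz).differentiableAt.hasDerivAt
  have hw'' : deriv (deriv w) z =
      ε * (2 * w z * deriv w z + 2 * w z + 2 * z * deriv w z) := by
    have hEq : deriv w =ᶠ[nhds z]
        fun x => -2 + ε * ((w x) ^ 2 + 2 * x * w x - 2 * α) := by
      filter_upwards [hU.mem_nhds hz] with x hx using hWH x hx
    rw [hEq.deriv_eq]
    have h := (((((hw'.pow 2).add (((hasDerivAt_id z).const_mul 2).mul hw')).sub_const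
      (2 * α)).const_mul ε).const_add (-2)).deriv
    refine h.trans ?_
    simp only [id]
    push_cast
    ring
  rw [hw'', hWH z hz, hβ]
  rcases hε with rfl | rfl <;> ring
end

section
/- Fix τ ∈ ℂ and define 𝔴(𝔷) = 8/(9·tan²(𝔷/√3 + τ) − 3) on the open set U ⊆ ℂ where cos(𝔷/√3 + τ) ≠ 0 and 9·tan²(𝔷/√3 + τ) − 3 ≠ 0. Then 𝔴 is analytic on U and satisfies 𝔴'(𝔷)² = (1/27)·𝔴(𝔷)·(3𝔴(𝔷) + 8)·(3𝔴(𝔷) + 2)² for all 𝔷 ∈ U. -/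
/-- The derivative of the complex tangent, expressed through the tangent itself. -/
theorem Complex.hasDerivAt_tan_one_add_sq {x : ℂ} (hx : Complex.cos x ≠ 0) :
    HasDerivAt Complex.tan (1 + Complex.tan x ^ 2) x := by
  convert Complex.hasDerivAt_tan hx using 1
  rw [Complex.tan_eq_sin_div_cos]
  field_simp
  linear_combination Complex.sin_sq_add_cos_sq x

/-- `𝔴(𝔷) = 8/(9·tan²(𝔷/√3 + τ) − 3)` satisfies the re-scaled Painlevé IV first
integral `𝔴'² = (1/27)·𝔴·(3𝔴 + 8)·(3𝔴 + 2)²`. -/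
theorem tan_solves_rescaled_painleveIV (τ : ℂ)
    (U : Set ℂ)
    (hU : U = {z : ℂ | Complex.cos (z / Real.sqrt 3 + τ) ≠ 0 ∧
      9 * Complex.tan (z / Real.sqrt 3 + τ) ^ 2 - 3 ≠ 0})
    (w : ℂ → ℂ) (hw : w = fun z => 8 / (9 * Complex.tan (z / Real.sqrt 3 + τ) ^ 2 - 3)) :
    AnalyticOnNhd ℂ w U ∧
      ∀ z ∈ U, (deriv w z) ^ 2 =
        (1 / 27) * w z * (3 * w z + 8) * (3 * w z + 2) ^ 2 := by
  subst hU hw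
  refine ⟨fun z hz => ?_, fun z hz => ?_⟩
  · obtain ⟨hc, hD⟩ := hz
    have hlin : AnalyticAt ℂ (fun z : ℂ => z / Real.sqrt 3 + τ) z := by fun_prop
    have htan : AnalyticAt ℂ (fun z : ℂ => Complex.tan (z / Real.sqrt 3 + τ)) z :=
      (Complex.analyticAt_sin.comp hlin).div (Complex.analyticAt_cos.comp hlin) hc
    exact analyticAt_const.div ((analyticAt_const.mul (htan.pow 2)).sub analyticAt_const) hD
  · obtain ⟨hc, hD⟩ := hz
    have hsqrt : ((Real.sqrt 3 : ℝ) : ℂ) ^ 2 = 3 := by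
      exact_mod_cast Real.sq_sqrt (show (0 : ℝ) ≤ 3 by norm_num)
    have hinv : (1 / ((Real.sqrt 3 : ℝ) : ℂ)) ^ 2 = 1 / 3 := by
      rw [div_pow, hsqrt, one_pow]
    have hlin : HasDerivAt (fun z : ℂ => z / Real.sqrt 3 + τ) (1 / Real.sqrt 3) z :=
      ((hasDerivAt_id z).div_const _).add_const τ
    have htan := (Complex.hasDerivAt_tan_one_add_sq hc).comp z hlin
    have hderiv := (hasDerivAt_const z (8 : ℂ)).div
      (((htan.pow 2).const_mul 9).sub_const 3) hD
    have hw' := hderiv.deriv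
    simp only [Function.comp_def, Pi.div_def, Pi.pow_def] at hw'
    rw [hw']
    beta_reduce
    generalize Complex.tan (z / Real.sqrt 3 + τ) = T at hD ⊢
    generalize 1 / ((Real.sqrt 3 : ℝ) : ℂ) = r at hinv ⊢
    field_simp
    ring_nf
    simp only [hinv]
    ring
end
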